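/- arXiv:1605.04970 — 3 statements merged into one kernel-verified Lean document; each statement's English description precedes it below -/
import Mathlib

section
/- Let A ⊂ ℤ^{n+1} be a finite set whose elements all have first coordinate 1, and let C_A ⊂ ℝ^{n+1} be the cone generated by A (rays from the origin through the convex hull of A). Suppose P_a > 0 for all a ∈ A, and write α = (α₀, α̃) ∈ ℂ^{n+1} with α̃ = (α₁,...,α_n). Then the integral ∫_{ℝ₊ⁿ} t^{α̃} / (Σ_{a∈A} P_a t^{ã})^{α₀} · dt₁/t₁ ⋯ dt_n/t_n converges absolutely if and only if Re(α) lies in the interior of C_A, where ã denotes the last n coordinates of a and t^{ã} = t₁^{a₁}⋯t_n^{a_n}. -/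
open MeasureTheory

/-- The integrand `t^{α̃} / ((Σ_{a∈A} P_a t^{ã})^{α₀} · t₁⋯t_n)` (the factor
`1/(t₁⋯t_n)` accounts for the measure `dt₁/t₁ ⋯ dt_n/t_n`). -/
noncomputable def toricIntegrand (n : ℕ) (A : Finset (Fin n → ℤ))
    (P : (Fin n → ℤ) → ℝ) (α0 : ℂ) (α : Fin n → ℂ) (t : Fin n → ℝ) : ℂ :=
  (∏ i, (t i : ℂ) ^ (α i)) /
    ((((∑ a ∈ A, P a * ∏ i, t i ^ (a i)) : ℝ) : ℂ) ^ α0 * ∏ i, (t i : ℂ))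

/-- The cone `C_A ⊆ ℝ^{n+1}` generated by the points `(1, ã)` for `ã ∈ A`. -/
def coneA (n : ℕ) (A : Finset (Fin n → ℤ)) : Set (ℝ × (Fin n → ℝ)) :=
  {x | ∃ c : (Fin n → ℤ) → ℝ, (∀ a, 0 ≤ c a) ∧
    x = ∑ a ∈ A, c a • (((1 : ℝ), fun i => (a i : ℝ)) : ℝ × (Fin n → ℝ))}

/-- The (generalized Feynman) integral `K(α)` over the positive orthant. -/
noncomputable def Kint (n : ℕ) (A : Finset (Fin n → ℤ)) (P : (Fin n → ℤ) → ℝ)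
    (α0 : ℂ) (α : Fin n → ℂ) : ℂ :=
  ∫ t in {t : Fin n → ℝ | ∀ i, 0 < t i}, toricIntegrand n A P α0 α t

/-- The Laurent polynomial `Σ_{a∈A} P_a t^a` in logarithmic coordinates `t = exp x`. -/
noncomputable def expSum {n : ℕ} (A : Finset (Fin n → ℤ)) (P : (Fin n → ℤ) → ℝ)
    (x : Fin n → ℝ) : ℝ :=
  ∑ a ∈ A, P a * Real.exp (∑ i, (a i : ℝ) * x i)

/-- The absolute value of the toric integrand in logarithmic coordinates, with respect to
Lebesgue measure. -/
noncomputable def expKernel {n : ℕ} (A : Finset (Fin n → ℤ)) (P : (Fin n → ℤ) → ℝ)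
    (s : ℝ) (β x : Fin n → ℝ) : ℝ :=
  Real.exp (∑ i, β i * x i) / expSum A P x ^ s

section

variable {n : ℕ} {A : Finset (Fin n → ℤ)} {P : (Fin n → ℤ) → ℝ}

theorem expSum_pos (hA : A.Nonempty) (hP : ∀ a ∈ A, 0 < P a) (x : Fin n → ℝ) :
    0 < expSum A P x :=
  Finset.sum_pos (fun a ha => mul_pos (hP a ha) (Real.exp_pos _)) hA

theorem expKernel_pos (hA : A.Nonempty) (hP : ∀ a ∈ A, 0 < P a) (s : ℝ) (β x : Fin n → ℝ) :
    0 < expKernel A P s β x :=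
  div_pos (Real.exp_pos _) (Real.rpow_pos_of_pos (expSum_pos hA hP x) _)

theorem continuous_expSum : Continuous (expSum A P) := by
  unfold expSum
  fun_prop

theorem continuous_expKernel (hA : A.Nonempty) (hP : ∀ a ∈ A, 0 < P a) (s : ℝ)
    (β : Fin n → ℝ) : Continuous (expKernel A P s β) := by
  unfold expKernel
  refine Continuous.div (by fun_prop) ?_
    fun x => (Real.rpow_pos_of_pos (expSum_pos hA hP x) _).ne'
  exact continuous_expSum.rpow_const fun x => Or.inl (expSum_pos hA hP x).ne'

theorem measurable_toricIntegrand (α0 : ℂ) (α : Fin n → ℂ) :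
    Measurable (toricIntegrand n A P α0 α) := by
  unfold toricIntegrand
  have h (i : Fin n) : Measurable fun t : Fin n → ℝ => (t i : ℂ) :=
    Complex.measurable_ofReal.comp (measurable_pi_apply i)
  refine Measurable.div (Finset.measurable_prod _ fun i _ => (h i).pow_const _)
    (Measurable.mul (Measurable.pow_const (Complex.measurable_ofReal.comp ?_) _)
      (Finset.measurable_prod _ fun i _ => h i))
  refine Finset.measurable_sum _ fun a _ => Measurable.const_mul
    (Finset.measurable_prod _ fun i _ => ?_) _
  exact (measurable_pi_apply i).pow_const (a i)

theorem prod_mul_norm_toricIntegrand_exp (hA : A.Nonempty) (hP : ∀ a ∈ A, 0 < P a)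
    (α0 : ℂ) (α : Fin n → ℂ) (x : Fin n → ℝ) :
    (∏ i, Real.exp (x i)) * ‖toricIntegrand n A P α0 α fun i => Real.exp (x i)‖ =
      expKernel A P α0.re (fun i => (α i).re) x := by
  have hS : ∑ a ∈ A, P a * ∏ i, Real.exp (x i) ^ (a i) = expSum A P x := by
    refine Finset.sum_congr rfl fun a _ => ?_
    rw [Real.exp_sum]
    refine congrArg _ (Finset.prod_congr rfl fun i _ => ?_)
    rw [← Real.rpow_intCast, ← Real.exp_mul, mul_comm]
  have hprod : (0 : ℝ) < ∏ i, Real.exp (x i) := Finset.prod_pos fun i _ => Real.exp_pos _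
  have hnum : ‖∏ i, ((Real.exp (x i) : ℝ) : ℂ) ^ α i‖ =
      Real.exp (∑ i, (α i).re * x i) := by
    rw [norm_prod, Real.exp_sum]
    refine Finset.prod_congr rfl fun i _ => ?_
    rw [Complex.norm_cpow_eq_rpow_re_of_pos (Real.exp_pos _), ← Real.exp_mul, mul_comm]
  have hden : ‖∏ i, ((Real.exp (x i) : ℝ) : ℂ)‖ = ∏ i, Real.exp (x i) := by
    rw [norm_prod]
    exact Finset.prod_congr rfl fun i _ => Complex.norm_of_nonneg (Real.exp_pos _).le
  unfold toricIntegrand expKernel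
  rw [hS, norm_div, norm_mul, hnum, hden,
    Complex.norm_cpow_eq_rpow_re_of_pos (expSum_pos hA hP x)]
  have := Real.rpow_pos_of_pos (expSum_pos hA hP x) α0.re
  field_simp

theorem integrableOn_toricIntegrand_iff (hA : A.Nonempty) (hP : ∀ a ∈ A, 0 < P a)
    (α0 : ℂ) (α : Fin n → ℂ) :
    IntegrableOn (toricIntegrand n A P α0 α) {t : Fin n → ℝ | ∀ i, 0 < t i} volume ↔
      Integrable (expKernel A P α0.re fun i => (α i).re) := by
  have himage : {t : Fin n → ℝ | ∀ i, 0 < t i} =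
      (fun x : Fin n → ℝ => fun i => Real.exp (x i)) '' Set.univ := by
    ext t
    simp only [Set.mem_ofPred_eq, Set.image_univ, Set.mem_range]
    constructor
    · exact fun h => ⟨fun i => Real.log (t i), funext fun i => Real.exp_log (h i)⟩
    · rintro ⟨x, rfl⟩ i
      exact Real.exp_pos _
  have hderiv (x : Fin n → ℝ) : HasFDerivAt (fun x : Fin n → ℝ => fun i => Real.exp (x i))
      (ContinuousLinearMap.pi fun i =>
        (Real.exp (x i) • ContinuousLinearMap.id ℝ ℝ).comp (ContinuousLinearMap.proj i)) x := by
    refine hasFDerivAt_pi.2 fun i => ?_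
    refine (hasFDerivAt_apply (𝕜 := ℝ) i x).exp.congr_fderiv ?_
    ext v
    simp
  have hinj : Set.InjOn (fun x : Fin n → ℝ => fun i => Real.exp (x i)) Set.univ :=
    fun x _ y _ h => funext fun i => Real.exp_injective (congrFun h i)
  have hdet (x : Fin n → ℝ) : |(ContinuousLinearMap.pi fun i =>
      (Real.exp (x i) • ContinuousLinearMap.id ℝ ℝ).comp
        (ContinuousLinearMap.proj (R := ℝ) (φ := fun _ : Fin n => ℝ) i)).det| =
      ∏ i, Real.exp (x i) := by
    rw [ContinuousLinearMap.det_pi]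
    simp [ContinuousLinearMap.det, Finset.abs_prod]
  rw [himage, integrableOn_image_iff_integrableOn_abs_det_fderiv_smul volume MeasurableSet.univ
    (fun x _ => (hderiv x).hasFDerivWithinAt) hinj, integrableOn_univ]
  simp only [hdet]
  rw [← integrable_norm_iff]
  · refine integrable_congr (Filter.Eventually.of_forall fun x => ?_)
    have hprod : (0 : ℝ) < ∏ i, Real.exp (x i) := Finset.prod_pos fun i _ => Real.exp_pos _
    simp only [norm_smul, Real.norm_of_nonneg hprod.le]
    exact prod_mul_norm_toricIntegrand_exp hA hP α0 α x
  · have hm : Measurable fun x : Fin n → ℝ => fun i => Real.exp (x i) :=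
      measurable_pi_lambda _ fun i => (measurable_pi_apply i).exp
    have hprod : Measurable fun x : Fin n → ℝ => ∏ i, Real.exp (x i) :=
      Finset.measurable_prod _ fun i _ => (measurable_pi_apply i).exp
    exact (hprod.smul ((measurable_toricIntegrand α0 α).comp hm)).aestronglyMeasurable

theorem expKernel_eq_exp_neg_mul (s : ℝ) (β γ x : Fin n → ℝ) :
    expKernel A P s β x =
      Real.exp (-∑ i, γ i * x i) * expKernel A P s (fun i => β i + γ i) x := by
  unfold expKernel
  rw [← mul_div_assoc, ← Real.exp_add]
  congr 2
  simp only [add_mul, Finset.sum_add_distrib]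
  ring

/-- At a point of the cone, the monomial is bounded by the power of the Laurent polynomial. -/
theorem expKernel_bounded_of_mem_coneA (hA : A.Nonempty) (hP : ∀ a ∈ A, 0 < P a) {s : ℝ}
    {β : Fin n → ℝ} (h : (s, β) ∈ coneA n A) : ∃ K, ∀ x, expKernel A P s β x ≤ K := by
  obtain ⟨c, hc, hx⟩ := h
  have hs : s = ∑ a ∈ A, c a := by
    have := congrArg Prod.fst hx
    simpa [Prod.fst_sum] using this
  have hβ (i : Fin n) : β i = ∑ a ∈ A, c a * a i := by
    have := congrFun (congrArg Prod.snd hx) i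
    simpa [Prod.snd_sum] using this
  refine ⟨∏ a ∈ A, ((P a)⁻¹) ^ c a, fun x => ?_⟩
  have hS := expSum_pos hA hP x
  rw [expKernel, div_le_iff₀ (Real.rpow_pos_of_pos hS _), hs, Real.rpow_sum_of_pos hS,
    ← Finset.prod_mul_distrib]
  have he : ∑ i, β i * x i = ∑ a ∈ A, (∑ i, (a i : ℝ) * x i) * c a := by
    simp only [hβ, Finset.sum_mul]
    rw [Finset.sum_comm]
    exact Finset.sum_congr rfl fun a _ => Finset.sum_congr rfl fun i _ => by ring
  rw [he, Real.exp_sum]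
  refine Finset.prod_le_prod (fun a _ => (Real.exp_pos _).le) fun a ha => ?_
  rw [Real.exp_mul, ← Real.mul_rpow (inv_pos.2 (hP a ha)).le hS.le]
  refine Real.rpow_le_rpow (Real.exp_pos _).le ?_ (hc a)
  rw [inv_mul_eq_div, le_div_iff₀' (hP a ha)]
  exact Finset.single_le_sum (f := fun a => P a * Real.exp (∑ i, (a i : ℝ) * x i))
    (fun b hb => (mul_pos (hP b hb) (Real.exp_pos _)).le) ha

theorem integrable_exp_neg_sum_abs {ε : ℝ} (hε : 0 < ε) :
    Integrable fun x : Fin n → ℝ => Real.exp (-∑ i, ε * |x i|) := by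
  have h1 : Integrable fun y : ℝ => Real.exp (-(ε * |y|)) := by
    rw [← integrableOn_univ, ← Set.Iic_union_Ioi (a := (0 : ℝ))]
    refine IntegrableOn.union ?_ ?_
    · refine (integrableOn_exp_mul_Iic hε 0).congr_fun (fun y hy => ?_) measurableSet_Iic
      simp [abs_of_nonpos (Set.mem_Iic.1 hy)]
    · refine (integrableOn_exp_mul_Ioi (neg_lt_zero.2 hε) 0).congr_fun (fun y hy => ?_)
        measurableSet_Ioi
      simp [abs_of_pos (Set.mem_Ioi.1 hy)]
  have h2 := Integrable.fintype_prod (ι := Fin n) (f := fun _ (y : ℝ) => Real.exp (-(ε * |y|)))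
    fun _ => h1
  refine h2.congr (Filter.Eventually.of_forall fun x => ?_)
  simp only [← Finset.sum_neg_distrib, Real.exp_sum]

theorem integrable_expKernel_of_mem_interior (hA : A.Nonempty) (hP : ∀ a ∈ A, 0 < P a) {s : ℝ}
    {β : Fin n → ℝ} (h : (s, β) ∈ interior (coneA n A)) : Integrable (expKernel A P s β) := by
  obtain ⟨r, hr, hball⟩ := Metric.mem_nhds_iff.1 (mem_interior_iff_mem_nhds.1 h)
  set ε := r / 2 with hε_def
  have hε : 0 < ε := half_pos hr
  have hmem (σ : Fin n → SignType) : (s, fun i => β i + ε * (σ i : ℝ)) ∈ coneA n A := by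
    refine hball ?_
    rw [Metric.mem_ball, Prod.dist_eq, dist_self, max_lt_iff]
    refine ⟨hr, lt_of_le_of_lt ((dist_pi_le_iff hε.le).2 fun i => ?_) (half_lt_self hr)⟩
    have : |((σ i : SignType) : ℝ)| ≤ 1 := by
      cases σ i <;> simp
    rw [Real.dist_eq, add_sub_cancel_left, abs_mul, abs_of_pos hε]
    exact mul_le_of_le_one_right hε.le this
  choose K hK using fun σ => expKernel_bounded_of_mem_coneA hA hP (hmem σ)
  obtain ⟨M, hM⟩ := (Set.finite_range K).bddAbove
  refine ((integrable_exp_neg_sum_abs (n := n) hε).mul_const M).mono'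
    (continuous_expKernel hA hP s β).aestronglyMeasurable
    (Filter.Eventually.of_forall fun x => ?_)
  rw [Real.norm_of_nonneg (expKernel_pos hA hP s β x).le,
    expKernel_eq_exp_neg_mul s β (fun i => ε * (SignType.sign (x i) : ℝ)) x]
  have hsign : ∑ i, ε * (SignType.sign (x i) : ℝ) * x i = ∑ i, ε * |x i| :=
    Finset.sum_congr rfl fun i _ => by rw [mul_assoc, sign_mul_self]
  rw [hsign]
  exact mul_le_mul_of_nonneg_left
    ((hK (fun i => SignType.sign (x i)) x).trans (hM ⟨_, rfl⟩)) (Real.exp_pos _).le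

/-- A positive continuous function whose values along some fixed direction do not decay both
forwards and backwards is not integrable. -/
theorem not_integrable_of_le_add_translates {E : Type*} [NormedAddCommGroup E]
    [NormedSpace ℝ E] [FiniteDimensional ℝ E] [MeasurableSpace E] [BorelSpace E]
    {μ : Measure E} [μ.IsAddHaarMeasure]
    {G : E → ℝ} (hpos : ∀ x, 0 < G x) {v : E} (hv : v ≠ 0)
    (hG : ∀ (k : ℕ) (x : E), G x ≤ G (x + (k : ℝ) • v) + G (x - (k : ℝ) • v)) :
    ¬ Integrable G μ := by
  intro hint
  have htail (w : E) (hw : w ≠ 0) : Filter.Tendsto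
      (fun k : ℕ => ∫ x in Metric.ball (0 : E) 1, G (x + (k : ℝ) • w) ∂μ)
      Filter.atTop (nhds 0) := by
    have hrw (k : ℕ) : ∫ x in Metric.ball (0 : E) 1, G (x + (k : ℝ) • w) ∂μ =
        ∫ x, (Metric.ball ((k : ℝ) • w) 1).indicator G x ∂μ := by
      rw [← integral_indicator Metric.isOpen_ball.measurableSet,
        ← integral_add_right_eq_self ((Metric.ball ((k : ℝ) • w) 1).indicator G) ((k : ℝ) • w)]
      refine integral_congr_ae (Filter.Eventually.of_forall fun x => ?_)
      have hball : x + (k : ℝ) • w ∈ Metric.ball ((k : ℝ) • w) 1 ↔ x ∈ Metric.ball (0 : E) 1 := by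
        simp
      by_cases hx : x ∈ Metric.ball (0 : E) 1
      · simp only [Set.indicator_of_mem hx, Set.indicator_of_mem (hball.2 hx)]
      · simp only [Set.indicator_of_notMem hx, Set.indicator_of_notMem (mt hball.1 hx)]
    simp only [hrw]
    rw [← integral_zero E ℝ (μ := μ)]
    refine tendsto_integral_of_dominated_convergence (fun x => G x)
      (fun k => hint.aestronglyMeasurable.indicator Metric.isOpen_ball.measurableSet) hint
      (fun k => Filter.Eventually.of_forall fun x => ?_)
      (Filter.Eventually.of_forall fun x => ?_)
    · exact (norm_indicator_le_norm_self _ _).trans (Real.norm_of_nonneg (hpos x).le).le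
    · refine tendsto_const_nhds.congr' ?_
      obtain ⟨N, hN⟩ := exists_nat_gt ((‖x‖ + 1) / ‖w‖)
      filter_upwards [Filter.eventually_ge_atTop N] with k hk
      refine (Set.indicator_of_notMem (fun hx => ?_) _).symm
      rw [mem_ball_iff_norm'] at hx
      have h1 : ‖x‖ + 1 < k * ‖w‖ := by
        rw [← div_lt_iff₀ (norm_pos_iff.2 hw)]
        exact hN.trans_le (by exact_mod_cast hk)
      have h2 := norm_sub_norm_le ((k : ℝ) • w) x
      rw [norm_smul, Real.norm_natCast] at h2
      linarith
  have hsum := (htail v hv).add (htail (-v) (neg_ne_zero.2 hv))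
  have hle : ∫ x in Metric.ball (0 : E) 1, G x ∂μ ≤ 0 + 0 := by
    refine ge_of_tendsto' hsum fun k => ?_
    have h1 : IntegrableOn (fun x => G (x + (k : ℝ) • v)) (Metric.ball 0 1) μ :=
      (hint.comp_add_right _).integrableOn
    have h2 : IntegrableOn (fun x => G (x + (k : ℝ) • -v)) (Metric.ball 0 1) μ :=
      (hint.comp_add_right _).integrableOn
    rw [← integral_add h1 h2]
    refine integral_mono hint.integrableOn (h1.add h2) fun x => ?_
    simpa [sub_eq_add_neg] using hG k x
  have hgt : 0 < ∫ x in Metric.ball (0 : E) 1, G x ∂μ := by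
    rw [setIntegral_pos_iff_support_of_nonneg_ae
      (Filter.Eventually.of_forall fun x => (hpos x).le) hint.integrableOn]
    have : Function.support G = Set.univ := Set.eq_univ_of_forall fun x => (hpos x).ne'
    rw [this, Set.univ_inter]
    exact Metric.measure_ball_pos μ 0 one_pos
  linarith

theorem expSum_sq_le (hP : ∀ a ∈ A, 0 < P a) (x w : Fin n → ℝ) :
    expSum A P x ^ 2 ≤ expSum A P (x + w) * expSum A P (x - w) := by
  refine Finset.sum_sq_le_sum_mul_sum_of_sq_le_mul A
    (fun a ha => (mul_pos (hP a ha) (Real.exp_pos _)).le)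
    (fun a ha => (mul_pos (hP a ha) (Real.exp_pos _)).le) fun a _ => ?_
  have : Real.exp (∑ i, (a i : ℝ) * x i) ^ 2 =
      Real.exp (∑ i, (a i : ℝ) * (x + w) i) * Real.exp (∑ i, (a i : ℝ) * (x - w) i) := by
    rw [← Real.exp_add, ← Real.exp_nat_mul, ← Finset.sum_add_distrib, Finset.mul_sum]
    congr 1
    refine Finset.sum_congr rfl fun i _ => ?_
    simp only [Pi.add_apply, Pi.sub_apply]
    push_cast
    ring
  rw [mul_pow, this]
  exact le_of_eq (by ring)

theorem expKernel_sq_le (hA : A.Nonempty) (hP : ∀ a ∈ A, 0 < P a) {s : ℝ} (hs : s ≤ 0)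
    (β x w : Fin n → ℝ) :
    expKernel A P s β x ^ 2 ≤ expKernel A P s β (x + w) * expKernel A P s β (x - w) := by
  unfold expKernel
  have hx := expSum_pos hA hP x
  have hp := expSum_pos hA hP (x + w)
  have hm := expSum_pos hA hP (x - w)
  have hexp : Real.exp (∑ i, β i * x i) ^ 2 =
      Real.exp (∑ i, β i * (x + w) i) * Real.exp (∑ i, β i * (x - w) i) := by
    rw [← Real.exp_add, ← Real.exp_nat_mul, ← Finset.sum_add_distrib, Finset.mul_sum]
    congr 1
    refine Finset.sum_congr rfl fun i _ => ?_
    simp only [Pi.add_apply, Pi.sub_apply]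
    push_cast
    ring
  rw [div_mul_div_comm, div_pow, ← hexp, ← Real.mul_rpow hp.le hm.le]
  refine div_le_div_of_nonneg_left (by positivity)
    (Real.rpow_pos_of_pos (mul_pos hp hm) _) ?_
  rw [sq (expSum A P x ^ s), ← Real.mul_rpow hx.le hx.le, ← sq]
  exact Real.rpow_le_rpow_of_nonpos (by positivity) (expSum_sq_le hP x w) hs

theorem not_integrable_expKernel_of_nonpos (hn : 0 < n) (hA : A.Nonempty)
    (hP : ∀ a ∈ A, 0 < P a) {s : ℝ} (hs : s ≤ 0) (β : Fin n → ℝ) :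
    ¬ Integrable (expKernel A P s β) := by
  have : Nonempty (Fin n) := ⟨⟨0, hn⟩⟩
  refine not_integrable_of_le_add_translates (expKernel_pos hA hP s β)
    (v := (1 : Fin n → ℝ)) one_ne_zero fun k x => ?_
  have h := expKernel_sq_le hA hP hs β x ((k : ℝ) • 1)
  have h0 := expKernel_pos hA hP s β x
  have h1 := expKernel_pos hA hP s β (x + (k : ℝ) • 1)
  have h2 := expKernel_pos hA hP s β (x - (k : ℝ) • 1)
  nlinarith

/-- If `v` is a direction on which the functional given by `v` is maximised over the Newton
polytope at or below its value at `β / s`, then the kernel does not decrease along `v`. -/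
theorem expKernel_le_add_smul (hA : A.Nonempty) (hP : ∀ a ∈ A, 0 < P a) {s : ℝ} (hs : 0 ≤ s)
    {β v : Fin n → ℝ} {m : ℝ} (hv : ∀ a ∈ A, ∑ i, (a i : ℝ) * v i ≤ m)
    (hβ : s * m ≤ ∑ i, β i * v i) {k : ℝ} (hk : 0 ≤ k) (x : Fin n → ℝ) :
    expKernel A P s β x ≤ expKernel A P s β (x + k • v) := by
  have hdot (γ : Fin n → ℝ) :
      ∑ i, γ i * (x + k • v) i = ∑ i, γ i * x i + k * ∑ i, γ i * v i := by
    rw [Finset.mul_sum, ← Finset.sum_add_distrib]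
    refine Finset.sum_congr rfl fun i _ => ?_
    simp only [Pi.add_apply, Pi.smul_apply, smul_eq_mul]
    ring
  have hS : expSum A P (x + k • v) ≤ Real.exp (k * m) * expSum A P x := by
    unfold expSum
    rw [Finset.mul_sum]
    refine Finset.sum_le_sum fun a ha => ?_
    rw [hdot, add_comm, Real.exp_add, mul_left_comm]
    have hPa := hP a ha
    have hva := hv a ha
    gcongr
  have hx := expSum_pos hA hP x
  have hxv := expSum_pos hA hP (x + k • v)
  unfold expKernel
  rw [div_le_div_iff₀ (Real.rpow_pos_of_pos hx _) (Real.rpow_pos_of_pos hxv _), hdot]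
  calc Real.exp (∑ i, β i * x i) * expSum A P (x + k • v) ^ s
      ≤ Real.exp (∑ i, β i * x i) * (Real.exp (k * m) * expSum A P x) ^ s :=
        mul_le_mul_of_nonneg_left (Real.rpow_le_rpow hxv.le hS hs) (Real.exp_pos _).le
    _ = Real.exp (∑ i, β i * x i + k * (s * m)) * expSum A P x ^ s := by
        rw [Real.mul_rpow (Real.exp_pos _).le hx.le, ← Real.exp_mul, Real.exp_add]
        ring_nf
    _ ≤ _ := by
        refine mul_le_mul_of_nonneg_right (Real.exp_le_exp.2 ?_)
          (Real.rpow_pos_of_pos hx _).le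
        gcongr

theorem smul_mem_coneA {x : ℝ × (Fin n → ℝ)} (hx : x ∈ coneA n A) {r : ℝ} (hr : 0 ≤ r) :
    r • x ∈ coneA n A := by
  obtain ⟨c, hc, rfl⟩ := hx
  refine ⟨fun a => r * c a, fun a => mul_nonneg hr (hc a), ?_⟩
  simp only [Finset.smul_sum, mul_smul]

theorem add_mem_coneA {x y : ℝ × (Fin n → ℝ)} (hx : x ∈ coneA n A) (hy : y ∈ coneA n A) :
    x + y ∈ coneA n A := by
  obtain ⟨c, hc, rfl⟩ := hx
  obtain ⟨d, hd, rfl⟩ := hy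
  refine ⟨fun a => c a + d a, fun a => add_nonneg (hc a) (hd a), ?_⟩
  simp only [add_smul, Finset.sum_add_distrib]

theorem one_mem_coneA_of_mem_convexHull {y : Fin n → ℝ}
    (hy : y ∈ convexHull ℝ ((fun a : Fin n → ℤ => fun i => (a i : ℝ)) ''
      (A : Set (Fin n → ℤ)))) : ((1 : ℝ), y) ∈ coneA n A := by
  have hconv : Convex ℝ {y : Fin n → ℝ | ((1 : ℝ), y) ∈ coneA n A} := by
    intro y hy z hz p q hp hq hpq
    have := add_mem_coneA (smul_mem_coneA hy hp) (smul_mem_coneA hz hq)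
    simpa [hpq] using this
  refine convexHull_min ?_ hconv hy
  rintro _ ⟨a, ha, rfl⟩
  classical
  refine ⟨fun b => if b = a then 1 else 0, fun b => by dsimp only; split_ifs <;> norm_num, ?_⟩
  rw [Finset.sum_eq_single_of_mem a ha fun b _ hb => by simp [hb]]
  simp

theorem mem_interior_coneA_of_div_mem_interior {s : ℝ} (hs : 0 < s) {β : Fin n → ℝ}
    (h : s⁻¹ • β ∈ interior (convexHull ℝ ((fun a : Fin n → ℤ => fun i => (a i : ℝ)) ''
      (A : Set (Fin n → ℤ))))) : (s, β) ∈ interior (coneA n A) := by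
  rw [mem_interior_iff_mem_nhds] at h ⊢
  have hcont : ContinuousAt (fun p : ℝ × (Fin n → ℝ) => p.1⁻¹ • p.2) (s, β) :=
    (continuousAt_fst.inv₀ hs.ne').smul continuousAt_snd
  filter_upwards [hcont h, continuousAt_fst.eventually (lt_mem_nhds hs)] with p hp hp1
  have := smul_mem_coneA (one_mem_coneA_of_mem_convexHull hp) (le_of_lt hp1)
  have hp1' : p.1 ≠ 0 := ne_of_gt hp1
  simpa [smul_smul, hp1'] using this

theorem mem_interior_of_integrable_expKernel (hn : 0 < n) (hA : A.Nonempty)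
    (hspan : affineSpan ℝ ((fun a : Fin n → ℤ => fun i => (a i : ℝ)) ''
      (A : Set (Fin n → ℤ))) = ⊤)
    (hP : ∀ a ∈ A, 0 < P a) {s : ℝ} {β : Fin n → ℝ} (h : Integrable (expKernel A P s β)) :
    (s, β) ∈ interior (coneA n A) := by
  rcases le_or_gt s 0 with hs | hs
  · exact absurd h (not_integrable_expKernel_of_nonpos hn hA hP hs β)
  refine mem_interior_coneA_of_div_mem_interior hs ?_
  by_contra hβ
  obtain ⟨f, hf, hle⟩ := geometric_hahn_banach_of_nonempty_interior_point
    (convex_convexHull ℝ _) hβ (interior_convexHull_nonempty_iff_affineSpan_eq_top.2 hspan)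
  set v : Fin n → ℝ := fun i => f fun j => if i = j then 1 else 0
  have hfv (x : Fin n → ℝ) : f x = ∑ i, x i * v i :=
    LinearMap.pi_apply_eq_sum_univ (f : (Fin n → ℝ) →ₗ[ℝ] ℝ) x
  have hv : v ≠ 0 := fun hv => hf <| by
    ext1 x
    simp [hfv, hv]
  refine not_integrable_of_le_add_translates (expKernel_pos hA hP s β) hv (fun k x => ?_) h
  refine (expKernel_le_add_smul hA hP hs.le (m := f (s⁻¹ • β)) (fun a ha => ?_) ?_
    k.cast_nonneg x).trans (le_add_of_nonneg_right (expKernel_pos hA hP s β _).le)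
  · rw [← hfv fun i => (a i : ℝ)]
    exact hle _ (subset_convexHull ℝ _ ⟨a, ha, rfl⟩)
  · rw [← hfv, map_smul, smul_eq_mul, mul_inv_cancel_left₀ hs.ne']

end

/-- The integral `∫_{ℝ₊ⁿ} t^{α̃}/(Σ_a P_a t^{ã})^{α₀} dt/t` converges absolutely if and
only if `Re α` lies in the interior of the cone generated by `A`. -/
theorem toric_integral_convergence (n : ℕ) (hn : 0 < n)
    (A : Finset (Fin n → ℤ)) (hA : A.Nonempty)
    (hspan : affineSpan ℝ ((fun a : Fin n → ℤ => fun i => (a i : ℝ)) ''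
      (A : Set (Fin n → ℤ))) = ⊤)
    (P : (Fin n → ℤ) → ℝ) (hP : ∀ a ∈ A, 0 < P a)
    (α0 : ℂ) (α : Fin n → ℂ) :
    IntegrableOn (toricIntegrand n A P α0 α) {t : Fin n → ℝ | ∀ i, 0 < t i} volume ↔
      ((α0.re, fun i => (α i).re) : ℝ × (Fin n → ℝ)) ∈ interior (coneA n A) := by
  rw [integrableOn_toricIntegrand_iff hA hP]
  exact ⟨mem_interior_of_integrable_expKernel hn hA hspan hP,
    integrable_expKernel_of_mem_interior hA hP⟩
end

section
/- Let Γ be a finite connected graph. The semigroup Σ ⊂ ℤ^{n+1} generated by the lattice points {(1, s) : s incidence vector of a spanning-tree complement} ∪ {(1, s + e_i) : s a spanning-tree complement incidence vector, 1 ≤ i ≤ n} is saturated: every integer point of the real cone generated by these points lies in Σ. -/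
open scoped Classical

/-- A finite multigraph on vertex type `V` with edge type `E` is given by an
endpoint map `G : E → Sym2 V`. -/
structure Subgraph {V E : Type} [Fintype V] [Fintype E] [DecidableEq V] [DecidableEq E]
    (G : E → Sym2 V) where
  verts : Finset V
  edges : Finset E
  incl : ∀ e ∈ edges, ∀ v ∈ G e, v ∈ verts

variable {V E : Type} [Fintype V] [Fintype E] [DecidableEq V] [DecidableEq E]

/-- Number of connected components of a subgraph. -/
noncomputable def comps (G : E → Sym2 V) (H : Subgraph G) : ℕ :=
  Nat.card (Quot fun a b : {v : V // v ∈ H.verts} => ∃ e ∈ H.edges, G e = s(a.1, b.1))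

/-- Cycle rank (first Betti number) `ℓ(H) = |E(H)| - |V(H)| + c(H)`. -/
noncomputable def cycleRank (G : E → Sym2 V) (H : Subgraph G) : ℤ :=
  (H.edges.card : ℤ) - (H.verts.card : ℤ) + (comps G H : ℤ)

/-- The spanning subgraph with all vertices and edge set `S`. -/
def spanningSub (G : E → Sym2 V) (S : Finset E) : Subgraph G where
  verts := Finset.univ
  edges := S
  incl := fun _ _ v _ => Finset.mem_univ v

/-- `T` is (the edge set of) a spanning tree of `G`. -/
noncomputable def IsSpanningTree (G : E → Sym2 V) (T : Finset E) : Prop :=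
  T.card + 1 = Fintype.card V ∧ comps G (spanningSub G T) = 1

/-- The graph `G` is connected. -/
noncomputable def GraphConnected (G : E → Sym2 V) : Prop :=
  comps G (spanningSub G Finset.univ) = 1

/-- Real incidence vector of a set of edges. -/
def ind (S : Finset E) : E → ℝ := fun e => if e ∈ S then 1 else 0

/-- Integer incidence vector of a set of edges. -/
def indZ (S : Finset E) : E → ℤ := fun e => if e ∈ S then 1 else 0

/-- The generators of the semigroup `Σ`: for each spanning tree `T` the point
`(1, 1_{Tᶜ})`, and for each spanning tree `T` and edge `i` the point
`(1, 1_{Tᶜ} + e_i)` (indexed by `Option E`). -/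
noncomputable def genZ (G : E → Sym2 V)
    (g : {T : Finset E // IsSpanningTree G T} × Option E) : ℤ × (E → ℤ) :=
  (1, indZ (g.1.1ᶜ) + g.2.elim 0 fun i => Pi.single i 1)

/-- Real cast `ℤ^{n+1} → ℝ^{n+1}`. -/
def castR (x : ℤ × (E → ℤ)) : ℝ × (E → ℝ) := ((x.1 : ℝ), fun e => (x.2 e : ℝ))

section LinearMatroidPartition

/-- The number of members of the family `F` that contain `a`. -/
def coverCount {ι α : Type*} [Fintype ι] [DecidableEq α] (F : ι → Finset α) (a : α) : ℕ :=
  ∑ i, if a ∈ F i then 1 else 0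

theorem coverCount_update {ι α : Type*} [Fintype ι] [DecidableEq ι] [DecidableEq α]
    (F : ι → Finset α) (i : ι) (A : Finset α) (a : α) :
    coverCount (Function.update F i A) a + (if a ∈ F i then 1 else 0) =
      coverCount F a + (if a ∈ A then 1 else 0) := by
  unfold coverCount
  rw [← Finset.add_sum_erase _ _ (Finset.mem_univ i),
    ← Finset.add_sum_erase (a := i) Finset.univ (fun j => if a ∈ F j then 1 else 0)
      (Finset.mem_univ i)]
  have : ∑ x ∈ Finset.univ.erase i, (if a ∈ Function.update F i A x then 1 else 0) =
      ∑ x ∈ Finset.univ.erase i, (if a ∈ F x then 1 else 0) :=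
    Finset.sum_congr rfl fun x hx => by
      rw [Function.update_of_ne (Finset.ne_of_mem_erase hx)]
  rw [this, Function.update_self]
  ring

theorem sum_coverCount {ι α : Type*} [Fintype ι] [DecidableEq α]
    (F : ι → Finset α) (D : Finset α) :
    ∑ a ∈ D, coverCount F a = ∑ i, (F i ∩ D).card := by
  unfold coverCount
  rw [Finset.sum_comm]
  refine Finset.sum_congr rfl fun i _ => ?_
  rw [Finset.inter_comm, ← Finset.filter_mem_eq_inter, Finset.card_filter]

/-- A family of linearly independent sets whose multiplicities are bounded by `u`. -/
structure IsPacking (K : Type*) {ι α W : Type*} [Fintype ι] [DecidableEq α] [Field K]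
    [AddCommGroup W] [Module K W] (φ : α → W) (u : α → ℕ) (F : ι → Finset α) : Prop where
  indep : ∀ i, LinearIndepOn K φ (F i : Set α)
  le : ∀ a, coverCount F a ≤ u a

/-- The element `b ∈ F i` can be exchanged, keeping independence, for an element `a` whose
multiplicity in `F` is below `u a`. -/
structure IsExchange (K : Type*) {ι α W : Type*} [Fintype ι] [DecidableEq ι] [DecidableEq α]
    [Field K] [AddCommGroup W] [Module K W] (φ : α → W) (u : α → ℕ) (F : ι → Finset α)
    (i : ι) (a b : α) : Prop where
  lt : coverCount F a < u a
  notMem : a ∉ F i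
  mem : b ∈ F i
  indep : LinearIndepOn K φ (insert a ((F i).erase b) : Finset α)

section

variable {K ι α W : Type*} [Fintype ι] [DecidableEq ι] [DecidableEq α] [Field K]
  [AddCommGroup W] [Module K W] {φ : α → W} {u : α → ℕ} {F : ι → Finset α} {i : ι} {a b : α}

theorem IsExchange.isPacking (h : IsExchange K φ u F i a b) (hF : IsPacking K φ u F) :
    IsPacking K φ u (Function.update F i (insert a ((F i).erase b))) where
  indep j := by
    by_cases hj : j = i
    · subst hj
      rw [Function.update_self]
      exact h.indep
    · rw [Function.update_of_ne hj]
      exact hF.indep j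
  le x := by
    have h1 := coverCount_update F i (insert a ((F i).erase b)) x
    have h2 := hF.le x
    have h3 := h.lt
    have h4 := h.notMem
    by_cases hx : x = a
    · subst hx
      simp [h4] at h1
      omega
    · by_cases hx' : x ∈ F i
      · rw [if_pos hx'] at h1
        split_ifs at h1 <;> omega
      · rw [if_neg hx', if_neg (by simp [hx, hx'])] at h1
        omega

theorem IsExchange.sum_coverCount [Fintype α] (h : IsExchange K φ u F i a b) :
    ∑ x, coverCount (Function.update F i (insert a ((F i).erase b))) x =
      ∑ x, coverCount F x := by
  have h1 := Finset.sum_congr (rfl : (Finset.univ : Finset α) = Finset.univ)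
    fun x _ => coverCount_update F i (insert a ((F i).erase b)) x
  rw [Finset.sum_add_distrib, Finset.sum_add_distrib] at h1
  simp only [Finset.sum_ite_mem, Finset.univ_inter, Finset.sum_const, smul_eq_mul,
    mul_one] at h1
  rw [Finset.card_insert_of_notMem (fun hh => h.notMem (Finset.mem_of_mem_erase hh)),
    Finset.card_erase_add_one h.mem] at h1
  omega

theorem IsExchange.coverCount_lt (h : IsExchange K φ u F i a b) (hF : IsPacking K φ u F) :
    coverCount (Function.update F i (insert a ((F i).erase b))) b < u b := by
  have h1 := coverCount_update F i (insert a ((F i).erase b)) b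
  have h2 := hF.le b
  have hne : b ≠ a := fun hba => h.notMem (hba ▸ h.mem)
  simp [hne, h.mem] at h1
  omega

end

theorem linearIndepOn_insert_erase {K α W : Type*} [DecidableEq α] [Field K]
    [AddCommGroup W] [Module K W] {φ : α → W} {S : Finset α}
    (hS : LinearIndepOn K φ (S : Set α)) {a b : α} (ha : a ∉ S) (hb : b ∈ S) {c : α → K}
    (hc : φ a = ∑ x ∈ S, c x • φ x) (hcb : c b ≠ 0) :
    LinearIndepOn K φ (insert a (S.erase b) : Finset α) := by
  rw [Finset.coe_insert, linearIndepOn_insert (by simp [ha])]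
  refine ⟨hS.mono (by simp), fun hmem => ?_⟩
  rw [← Finset.add_sum_erase _ _ hb] at hc
  have hrest : ∑ x ∈ S.erase b, c x • φ x ∈ Submodule.span K (φ '' (S.erase b : Finset α)) :=
    Submodule.sum_mem _ fun x hx => Submodule.smul_mem _ _ (Submodule.subset_span ⟨x, hx, rfl⟩)
  have h1 : c b • φ b ∈ Submodule.span K (φ '' (S.erase b : Finset α)) := by
    rw [eq_sub_of_add_eq hc.symm]
    exact Submodule.sub_mem _ hmem hrest
  rw [Submodule.smul_mem_iff _ hcb] at h1
  rw [← Finset.insert_erase hb, Finset.coe_insert] at hS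
  exact hS.notMem_span_of_insert (by simp) h1

/-- Edmonds' matroid partition theorem for linear matroids, with multiplicities. -/
theorem exists_linearIndepOn_cover {K ι α W : Type*} [Fintype ι] [Fintype α] [DecidableEq α]
    [Field K] [AddCommGroup W] [Module K W] (φ : α → W) (u : α → ℕ)
    (h : ∀ D : Finset α,
      ∑ a ∈ D, u a ≤ Fintype.card ι * Module.finrank K (Submodule.span K (φ '' D))) :
    ∃ F : ι → Finset α, (∀ i, LinearIndepOn K φ (F i : Set α)) ∧
      ∀ a, u a ≤ coverCount F a := by
  classical
  obtain ⟨F, hF, hmax⟩ := Finset.exists_max_image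
    (Finset.univ.filter fun F : ι → Finset α => IsPacking K φ u F)
    (fun F => ∑ a, coverCount F a)
    ⟨fun _ => ∅, by
      simp only [Finset.mem_filter, Finset.mem_univ, true_and]
      exact ⟨fun i => by simp, fun a => by simp [coverCount]⟩⟩
  simp only [Finset.mem_filter, Finset.mem_univ, true_and] at hF hmax
  refine ⟨F, hF.indep, ?_⟩
  by_contra! hlt
  obtain ⟨a₀, ha₀⟩ := hlt
  let R : (ι → Finset α) → (ι → Finset α) → Prop := fun A B =>
    ∃ i a b, IsExchange K φ u A i a b ∧ B = Function.update A i (insert a ((A i).erase b))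
  have hpack : ∀ A, Relation.ReflTransGen R F A → IsPacking K φ u A ∧
      ∑ a, coverCount A a = ∑ a, coverCount F a := by
    intro A hA
    induction hA with
    | refl => exact ⟨hF, rfl⟩
    | tail _ hR ih =>
      obtain ⟨i, a, b, hex, rfl⟩ := hR
      exact ⟨hex.isPacking ih.1, hex.sum_coverCount.trans ih.2⟩
  let D : Finset α := Finset.univ.filter fun a =>
    ∃ A, Relation.ReflTransGen R F A ∧ coverCount A a < u a
  have hD : ∀ a, a ∈ D ↔ ∃ A, Relation.ReflTransGen R F A ∧ coverCount A a < u a := by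
    simp [D]
  -- Elements of deficient multiplicity lie in the span of `A i ∩ D`.
  have hspan : ∀ A, Relation.ReflTransGen R F A → ∀ a, coverCount A a < u a → ∀ i,
      φ a ∈ Submodule.span K (φ '' (A i ∩ D : Finset α)) := by
    intro A hA a ha i
    have haD : a ∈ D := (hD a).2 ⟨A, hA, ha⟩
    obtain ⟨hAp, hAsum⟩ := hpack A hA
    by_cases hai : a ∈ A i
    · exact Submodule.subset_span ⟨a, by simp [hai, haD], rfl⟩
    have hmem : φ a ∈ Submodule.span K (φ '' (A i : Set α)) := by
      by_contra hnot
      have hpk : IsPacking K φ u (Function.update A i (insert a (A i))) := by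
        refine ⟨fun j => ?_, fun x => ?_⟩
        · by_cases hj : j = i
          · subst hj
            rw [Function.update_self, Finset.coe_insert,
              linearIndepOn_insert (by simpa using hai)]
            exact ⟨hAp.indep j, hnot⟩
          · rw [Function.update_of_ne hj]
            exact hAp.indep j
        · have h1 := coverCount_update A i (insert a (A i)) x
          have h2 := hAp.le x
          by_cases hx : x = a
          · subst hx
            simp [hai] at h1
            omega
          · simp [hx] at h1
            omega
      have h1 := hmax _ hpk
      have h2 := Finset.sum_congr (rfl : (Finset.univ : Finset α) = Finset.univ)
        fun x _ => coverCount_update A i (insert a (A i)) x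
      rw [Finset.sum_add_distrib, Finset.sum_add_distrib] at h2
      simp only [Finset.sum_ite_mem, Finset.univ_inter, Finset.sum_const, smul_eq_mul,
        mul_one] at h2
      rw [Finset.card_insert_of_notMem hai] at h2
      omega
    rw [Submodule.mem_span_image_finset_iff_exists_fun'] at hmem
    obtain ⟨c, hc⟩ := hmem
    rw [← hc]
    refine Submodule.sum_mem _ fun b hb => ?_
    by_cases hcb : c b = 0
    · simp [hcb]
    have hex : IsExchange K φ u A i a b :=
      ⟨ha, hai, hb, linearIndepOn_insert_erase (hAp.indep i) hai hb hc.symm hcb⟩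
    have hbD : b ∈ D := (hD b).2 ⟨_, hA.tail ⟨i, a, b, hex, rfl⟩, hex.coverCount_lt hAp⟩
    exact Submodule.smul_mem _ _ (Submodule.subset_span ⟨b, by simp [hb, hbD], rfl⟩)
  have hle : ∀ A, Relation.ReflTransGen R F A → ∀ i,
      Submodule.span K (φ '' (A i ∩ D : Finset α)) ≤
        Submodule.span K (φ '' (F i ∩ D : Finset α)) := by
    intro A hA
    induction hA with
    | refl => exact fun i => le_rfl
    | @tail B C hB hR ih =>
      obtain ⟨i, a, b, hex, rfl⟩ := hR
      intro j
      by_cases hj : j = i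
      · subst hj
        refine le_trans (Submodule.span_le.2 ?_) (ih j)
        rintro _ ⟨x, hx, rfl⟩
        simp only [Function.update_self, Finset.coe_inter, Finset.coe_insert, Finset.coe_erase,
          Set.mem_inter_iff, Set.mem_insert_iff] at hx
        rcases hx with ⟨rfl | hx, hxD⟩
        · exact hspan B hB _ hex.lt j
        · exact Submodule.subset_span ⟨x, by simpa using ⟨hx.1, hxD⟩, rfl⟩
      · rw [Function.update_of_ne hj]
        exact ih j
  have hrank : ∀ i, Module.finrank K (Submodule.span K (φ '' D)) ≤ (F i ∩ D).card := by
    intro i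
    have h1 : Submodule.span K (φ '' D) ≤
        Submodule.span K (((F i ∩ D).image φ : Finset W) : Set W) := by
      rw [Finset.coe_image]
      refine Submodule.span_le.2 ?_
      rintro _ ⟨a, ha, rfl⟩
      obtain ⟨A, hA, haA⟩ := (hD a).1 ha
      exact hle A hA i (hspan A hA a haA i)
    refine (Submodule.finrank_mono h1).trans ?_
    exact (finrank_span_finset_le_card _).trans Finset.card_image_le
  have h1 : Fintype.card ι * Module.finrank K (Submodule.span K (φ '' D)) ≤
      ∑ a ∈ D, coverCount F a := by
    rw [sum_coverCount, ← smul_eq_mul, ← Finset.card_univ]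
    exact Finset.card_nsmul_le_sum _ _ _ fun i _ => hrank i
  have h2 : ∑ a ∈ D, coverCount F a < ∑ a ∈ D, u a :=
    Finset.sum_lt_sum (fun a _ => hF.le a) ⟨a₀, (hD a₀).2 ⟨F, .refl, ha₀⟩, ha₀⟩
  exact absurd (h D) (by omega)

end LinearMatroidPartition

section GraphicMatroid

/-- The vector over `ZMod 2` representing the edge `e` in the graphic matroid. -/
def edgeVec (G : E → Sym2 V) (e : E) : V → ZMod 2 :=
  Sym2.lift ⟨fun a b => Pi.single a 1 + Pi.single b 1, fun _ _ => add_comm _ _⟩ (G e)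

theorem edgeVec_of_eq {X Y : Type} [DecidableEq X] {G : Y → Sym2 X} {e : Y} {a b : X}
    (h : G e = s(a, b)) :
    edgeVec G e = Pi.single a 1 + Pi.single b 1 := by
  simp [edgeVec, h]

/-- The sum of the coordinates, as a linear functional. -/
def coordSum (V : Type) [Fintype V] : (V → ZMod 2) →ₗ[ZMod 2] ZMod 2 :=
  ∑ v, LinearMap.proj v

theorem coordSum_apply {X : Type} [Fintype X] (w : X → ZMod 2) : coordSum X w = ∑ v, w v := by
  simp [coordSum]

theorem single_add_single_mem_span {G : E → Sym2 V} {S : Finset E}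
    (hS : comps G (spanningSub G S) = 1) (a b : V) :
    (Pi.single a 1 + Pi.single b 1 : V → ZMod 2) ∈
      Submodule.span (ZMod 2) (edgeVec G '' S) := by
  have hchar : ∀ w : V → ZMod 2, w + w = 0 := fun w =>
    funext fun v => CharTwo.add_self_eq_zero _
  have hsub := (Nat.card_eq_one_iff_unique.1 hS).1
  have heq := Quot.eqvGen_exact (hsub.elim (Quot.mk _ ⟨a, Finset.mem_univ a⟩)
    (Quot.mk _ ⟨b, Finset.mem_univ b⟩))
  have key : ∀ p q : {v : V // v ∈ (spanningSub G S).verts},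
      Relation.EqvGen (fun a b => ∃ e ∈ (spanningSub G S).edges, G e = s(a.1, b.1)) p q →
      (Pi.single p.1 1 + Pi.single q.1 1 : V → ZMod 2) ∈
        Submodule.span (ZMod 2) (edgeVec G '' S) := by
    intro p q hpq
    induction hpq with
    | rel p q h =>
      obtain ⟨e, he, hG⟩ := h
      exact Submodule.subset_span ⟨e, he, edgeVec_of_eq hG⟩
    | refl p =>
      rw [hchar]
      exact Submodule.zero_mem _
    | symm p q _ ih => rwa [add_comm]
    | trans p q r _ _ ih₁ ih₂ =>
      have h := Submodule.add_mem _ ih₁ ih₂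
      rwa [add_assoc, ← add_assoc (Pi.single q.1 1), hchar, zero_add] at h
  exact key _ _ heq

theorem comps_eq_one_of_mem_span [Nonempty V] {G : E → Sym2 V} {S : Finset E}
    (hS : ∀ a b : V, (Pi.single a 1 + Pi.single b 1 : V → ZMod 2) ∈
      Submodule.span (ZMod 2) (edgeVec G '' S)) :
    comps G (spanningSub G S) = 1 := by
  obtain ⟨v₀⟩ := ‹Nonempty V›
  refine Nat.card_eq_one_iff_unique.2 ⟨⟨?_⟩, ⟨Quot.mk _ ⟨v₀, Finset.mem_univ v₀⟩⟩⟩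
  rintro ⟨⟨a, ha⟩⟩ ⟨⟨b, hb⟩⟩
  by_contra hne
  let r : {v : V // v ∈ (spanningSub G S).verts} →
      {v : V // v ∈ (spanningSub G S).verts} → Prop :=
    fun a b => ∃ e ∈ (spanningSub G S).edges, G e = s(a.1, b.1)
  let q : V → Quot r := fun v => Quot.mk r ⟨v, Finset.mem_univ v⟩
  let L : (V → ZMod 2) →ₗ[ZMod 2] ZMod 2 :=
    ∑ v, if q v = q a then LinearMap.proj v else 0
  have hL : ∀ v, L (Pi.single v 1) = if q v = q a then 1 else 0 := by
    intro v
    simp only [L, LinearMap.sum_apply]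
    rw [Finset.sum_eq_single v]
    · split_ifs <;> simp
    · intro w _ hw
      split_ifs <;> simp [hw]
    · simp
  have hker : Submodule.span (ZMod 2) (edgeVec G '' S) ≤ LinearMap.ker L := by
    rw [Submodule.span_le]
    rintro _ ⟨e, he, rfl⟩
    obtain ⟨⟨x, y⟩, hxy⟩ := Quot.exists_rep (G e)
    have hxy' : G e = s(x, y) := hxy.symm
    have hq : q x = q y := Quot.sound ⟨e, he, hxy'⟩
    simp only [SetLike.mem_coe, LinearMap.mem_ker]
    rw [edgeVec_of_eq hxy', map_add, hL, hL, hq, CharTwo.add_self_eq_zero]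
  have h := hker (hS a b)
  rw [LinearMap.mem_ker, map_add, hL, hL, if_pos rfl, if_neg (fun h => hne h.symm)] at h
  simp at h

theorem nonempty_of_comps_eq_one {G : E → Sym2 V} {S : Finset E}
    (hS : comps G (spanningSub G S) = 1) : Nonempty V := by
  obtain ⟨⟨v⟩⟩ := (Nat.card_eq_one_iff_unique.1 hS).2
  exact ⟨v.1⟩

theorem finrank_span_edgeVec {G : E → Sym2 V} {S : Finset E}
    (hS : comps G (spanningSub G S) = 1) :
    Module.finrank (ZMod 2) (Submodule.span (ZMod 2) (edgeVec G '' S)) + 1 =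
      Fintype.card V := by
  obtain ⟨v₀⟩ := nonempty_of_comps_eq_one hS
  have hspan : Submodule.span (ZMod 2) (edgeVec G '' S) = LinearMap.ker (coordSum V) := by
    refine le_antisymm ?_ fun w hw => ?_
    · rw [Submodule.span_le]
      rintro _ ⟨e, he, rfl⟩
      obtain ⟨⟨x, y⟩, hxy⟩ := Quot.exists_rep (G e)
      have hxy' : G e = s(x, y) := hxy.symm
      simp only [SetLike.mem_coe, LinearMap.mem_ker]
      rw [edgeVec_of_eq hxy', map_add, coordSum_apply, coordSum_apply]
      simp only [Finset.sum_pi_single', Finset.mem_univ, if_true]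
      exact CharTwo.add_self_eq_zero _
    · rw [LinearMap.mem_ker, coordSum_apply] at hw
      have hw' : w = ∑ v, w v • (Pi.single v 1 + Pi.single v₀ 1 : V → ZMod 2) := by
        simp only [smul_add, Finset.sum_add_distrib, ← Finset.sum_smul, hw, zero_smul, add_zero]
        exact pi_eq_sum_univ' w
      rw [hw']
      exact Submodule.sum_mem _ fun v _ =>
        Submodule.smul_mem _ _ (single_add_single_mem_span hS v v₀)
  have hrange : LinearMap.range (coordSum V) = ⊤ := by
    rw [LinearMap.range_eq_top]
    intro t
    exact ⟨Pi.single v₀ t, by rw [coordSum_apply]; simp⟩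
  have h := LinearMap.finrank_range_add_finrank_ker (coordSum V)
  rw [hrange, finrank_top, Module.finrank_self, Module.finrank_fintype_fun_eq_card] at h
  rw [hspan]
  omega

theorem LinearIndepOn.finrank_span_image_finset {K α W : Type*} [Field K] [AddCommGroup W]
    [Module K W] {φ : α → W} {S : Finset α} (hS : LinearIndepOn K φ (S : Set α)) :
    Module.finrank K (Submodule.span K (φ '' S)) = S.card := by
  have h := finrank_span_eq_card hS
  rw [← Set.image_eq_range] at h
  exact h.trans (Fintype.card_coe S)

theorem IsSpanningTree.linearIndepOn {G : E → Sym2 V} {T : Finset E}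
    (hT : IsSpanningTree G T) : LinearIndepOn (ZMod 2) (edgeVec G) (T : Set E) := by
  have h := finrank_span_edgeVec hT.2
  refine linearIndependent_iff_card_eq_finrank_span.2 ?_
  rw [Set.finrank, ← Set.image_eq_range]
  have h1 := hT.1
  have h2 := Fintype.card_coe T
  change Fintype.card T = _
  omega

theorem exists_isSpanningTree_superset {G : E → Sym2 V} (hconn : GraphConnected G)
    {S : Finset E} (hS : LinearIndepOn (ZMod 2) (edgeVec G) (S : Set E)) :
    ∃ T, IsSpanningTree G T ∧ S ⊆ T := by
  have hsub : (S : Set E) ⊆ ((Finset.univ : Finset E) : Set E) := by simp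
  have hspan := hS.span_image_extend_eq_span_image hsub
  have hind := hS.linearIndepOn_extend hsub
  have hsup := hS.subset_extend hsub
  have := nonempty_of_comps_eq_one hconn
  lift hS.extend hsub to Finset E using Set.toFinite _ with T
  refine ⟨T, ⟨?_, ?_⟩, Finset.coe_subset.1 hsup⟩
  · rw [← hind.finrank_span_image_finset, hspan]
    exact finrank_span_edgeVec hconn
  · refine comps_eq_one_of_mem_span fun a b => ?_
    rw [hspan]
    exact single_add_single_mem_span hconn a b

theorem IsSpanningTree.card_inter_le {G : E → Sym2 V} {T : Finset E}
    (hT : IsSpanningTree G T) (D : Finset E) :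
    (T ∩ D).card ≤
      Module.finrank (ZMod 2) (Submodule.span (ZMod 2) (edgeVec G '' D)) := by
  have h : LinearIndepOn (ZMod 2) (edgeVec G) ((T ∩ D : Finset E) : Set E) :=
    hT.linearIndepOn.mono (by simp)
  rw [← h.finrank_span_image_finset]
  exact Submodule.finrank_mono (Submodule.span_mono (Set.image_mono (by simp)))

end GraphicMatroid

section Saturation

/-- A vector of naturals with sum at most `k` is a sum of `k` vectors, each zero or a unit
vector. -/
theorem exists_sum_single_eq {α : Type*} [Fintype α] [DecidableEq α] {k : ℕ} (z : α → ℕ)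
    (hz : ∑ a, z a ≤ k) :
    ∃ o : Fin k → Option α, ∀ a,
      ∑ i, (o i).elim (0 : α → ℤ) (fun b => Pi.single b 1) a = z a := by
  obtain ⟨j⟩ := Function.Embedding.nonempty_of_card_le
    (α := Σ a, Fin (z a)) (β := Fin k) (by simpa using hz)
  refine ⟨fun i => (Function.partialInv j i).map Sigma.fst, fun a => ?_⟩
  rw [← Fintype.sum_of_injective j j.injective
    (fun p : Σ a, Fin (z a) => (Pi.single p.1 1 : α → ℤ) a)]
  · rw [Fintype.sum_sigma]
    simp [Pi.single_apply]
  · intro i hi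
    have : Function.partialInv j i = none := by
      unfold Function.partialInv
      rw [dif_neg]
      simpa using hi
    simp [this]
  · intro p
    simp [Function.partialInv_left j.injective]

theorem sum_indZ_compl {G : E → Sym2 V} {T : Finset E} (hT : IsSpanningTree G T) :
    ∑ e, indZ Tᶜ e = (Fintype.card E : ℤ) - Fintype.card V + 1 := by
  have h1 := hT.1
  have h2 := Finset.card_add_card_compl T
  simp only [indZ, Finset.sum_ite_mem, Finset.univ_inter, Finset.sum_const, nsmul_eq_mul,
    mul_one]
  omega

theorem sum_indZ_compl_add_coverCount {k : ℕ} (T : Fin k → Finset E) (e : E) :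
    ∑ i, indZ (T i)ᶜ e + coverCount T e = k := by
  have h : ∀ i, indZ (T i)ᶜ e + (if e ∈ T i then 1 else 0) = 1 := fun i => by
    by_cases he : e ∈ T i <;> simp [indZ, he]
  have := Finset.sum_congr (rfl : (Finset.univ : Finset (Fin k)) = Finset.univ) fun i _ => h i
  rw [Finset.sum_add_distrib] at this
  simpa [coverCount] using this

theorem sum_option_single_le (o : Option E) :
    ∑ e, o.elim (0 : E → ℤ) (fun i => Pi.single i 1) e ≤ 1 := by
  cases o <;> simp

theorem option_single_nonneg {α : Type*} [DecidableEq α] (o : Option α) (e : α) :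
    0 ≤ o.elim (0 : α → ℤ) (fun i => Pi.single i 1) e := by
  cases o with
  | none => simp
  | some i => by_cases h : e = i <;> simp [h]

end Saturation

/-- The semigroup generated by the points `(1, 1_{Tᶜ})` and `(1, 1_{Tᶜ} + e_i)` is
saturated: every integer point of the real cone generated by these points is a
nonnegative integer combination of them. -/
theorem semigroup_saturated (G : E → Sym2 V) (hconn : GraphConnected G)
    (x : ℤ × (E → ℤ))
    (hx : ∃ c : ({T : Finset E // IsSpanningTree G T} × Option E) → ℝ,
      (∀ g, 0 ≤ c g) ∧
      castR x = ∑ᶠ g : {T : Finset E // IsSpanningTree G T} × Option E,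
        c g • castR (genZ G g)) :
    ∃ m : ({T : Finset E // IsSpanningTree G T} × Option E) → ℕ,
      x = ∑ᶠ g : {T : Finset E // IsSpanningTree G T} × Option E, m g • genZ G g := by
  classical
  obtain ⟨c, hc, hx⟩ := hx
  rw [finsum_eq_sum_of_fintype] at hx
  have hx1 : (x.1 : ℝ) = ∑ g, c g := by
    have h := congrArg Prod.fst hx
    simpa [castR, genZ, Prod.fst_sum] using h
  have hx2 : ∀ e, (x.2 e : ℝ) = ∑ g, c g * ((genZ G g).2 e : ℝ) := by
    intro e
    have h := congrFun (congrArg Prod.snd hx) e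
    simpa [castR, Prod.snd_sum] using h
  have hk0 : 0 ≤ x.1 := by
    have : (0 : ℝ) ≤ x.1 := hx1 ▸ Finset.sum_nonneg fun g _ => hc g
    exact_mod_cast this
  obtain ⟨k, hk⟩ := Int.eq_ofNat_of_zero_le hk0
  rw [hk, Int.cast_natCast] at hx1
  have hrank : ∀ D : Finset E, ∑ e ∈ D, (k - x.2 e).toNat ≤
      Fintype.card (Fin k) *
        Module.finrank (ZMod 2) (Submodule.span (ZMod 2) (edgeVec G '' D)) := by
    intro D
    set r := Module.finrank (ZMod 2) (Submodule.span (ZMod 2) (edgeVec G '' D)) with hr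
    have hpt : ∀ e, (k : ℝ) - x.2 e ≤ ∑ g, c g * (if e ∈ g.1.1 then 1 else 0) := by
      intro e
      rw [hx1, hx2, ← Finset.sum_sub_distrib]
      refine Finset.sum_le_sum fun g _ => ?_
      have h1 : 1 - (genZ G g).2 e ≤ if e ∈ g.1.1 then 1 else 0 := by
        have := option_single_nonneg g.2 e
        by_cases he : e ∈ g.1.1 <;> simp [genZ, indZ, he] <;> linarith
      have h2 : (1 : ℝ) - ((genZ G g).2 e : ℝ) ≤ if e ∈ g.1.1 then 1 else 0 := by
        exact_mod_cast h1
      nlinarith [mul_le_mul_of_nonneg_left h2 (hc g)]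
    have hpt' : ∀ e, (((k - x.2 e).toNat : ℕ) : ℝ) ≤
        ∑ g, c g * (if e ∈ g.1.1 then 1 else 0) := by
      intro e
      have h0 : 0 ≤ ∑ g, c g * (if e ∈ g.1.1 then (1 : ℝ) else 0) :=
        Finset.sum_nonneg fun g _ => mul_nonneg (hc g) (by split_ifs <;> norm_num)
      rcases le_total 0 ((k : ℤ) - x.2 e) with h | h
      · have h3 : (((k - x.2 e).toNat : ℕ) : ℝ) = (k : ℝ) - x.2 e := by
          exact_mod_cast congrArg (Int.cast : ℤ → ℝ) (Int.toNat_of_nonneg h)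
        rw [h3]
        exact hpt e
      · rw [Int.toNat_of_nonpos h]
        simpa using h0
    have hreal : ((∑ e ∈ D, (k - x.2 e).toNat : ℕ) : ℝ) ≤ k * r := by
      push_cast
      refine (Finset.sum_le_sum fun e _ => hpt' e).trans ?_
      rw [Finset.sum_comm, hx1, Finset.sum_mul]
      refine Finset.sum_le_sum fun g _ => ?_
      rw [← Finset.mul_sum]
      refine mul_le_mul_of_nonneg_left ?_ (hc g)
      have h := g.1.2.card_inter_le D
      rw [← hr] at h
      rw [Finset.sum_ite_mem, Finset.sum_const, nsmul_eq_mul, mul_one, Finset.inter_comm]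
      exact_mod_cast h
    rw [Fintype.card_fin]
    exact_mod_cast hreal
  obtain ⟨F, hF, hcov⟩ := exists_linearIndepOn_cover (K := ZMod 2) (edgeVec G) _ hrank
  choose T hT hFT using fun i => exists_isSpanningTree_superset hconn (hF i)
  have hmono : ∀ e, coverCount F e ≤ coverCount T e := fun e =>
    Finset.sum_le_sum fun i _ => by
      by_cases he : e ∈ F i
      · simp [he, hFT i he]
      · simp [he]
  have hle : ∀ e, ∑ i, indZ (T i)ᶜ e ≤ x.2 e := by
    intro e
    have h1 := sum_indZ_compl_add_coverCount T e
    have h2 := hcov e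
    have h3 := hmono e
    omega
  have htotal : ∑ e, x.2 e ≤ k * ((Fintype.card E : ℤ) - Fintype.card V + 1) + k := by
    have hreal : ((∑ e, x.2 e : ℤ) : ℝ) ≤
        k * (((Fintype.card E : ℤ) - Fintype.card V + 1 : ℤ) : ℝ) + k := by
      rw [Int.cast_sum, Finset.sum_congr rfl fun e _ => hx2 e, Finset.sum_comm, hx1,
        Finset.sum_mul, ← Finset.sum_add_distrib]
      refine Finset.sum_le_sum fun g _ => ?_
      rw [← Finset.mul_sum, ← mul_add_one]
      refine mul_le_mul_of_nonneg_left ?_ (hc g)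
      have h : ∑ e, (genZ G g).2 e ≤ (Fintype.card E : ℤ) - Fintype.card V + 1 + 1 := by
        simp only [genZ, Pi.add_apply, Finset.sum_add_distrib, sum_indZ_compl g.1.2]
        linarith [sum_option_single_le g.2]
      exact_mod_cast h
    exact_mod_cast hreal
  have hz : ∑ e, (x.2 e - ∑ i, indZ (T i)ᶜ e).toNat ≤ k := by
    zify
    rw [Finset.sum_congr rfl fun e _ => Int.toNat_of_nonneg (sub_nonneg.2 (hle e)),
      Finset.sum_sub_distrib, Finset.sum_comm,
      Finset.sum_congr rfl fun i _ => sum_indZ_compl (hT i)]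
    simp only [Finset.sum_const, Finset.card_univ, Fintype.card_fin, nsmul_eq_mul]
    linarith
  obtain ⟨o, ho⟩ := exists_sum_single_eq _ hz
  let t : Fin k → {T : Finset E // IsSpanningTree G T} × Option E := fun i => (⟨T i, hT i⟩, o i)
  refine ⟨fun g => ∑ i, if t i = g then 1 else 0, ?_⟩
  rw [finsum_eq_sum_of_fintype]
  simp only [Finset.sum_smul]
  rw [Finset.sum_comm]
  simp only [ite_smul, one_smul, zero_smul, Finset.sum_ite_eq, Finset.mem_univ, if_true]
  refine Prod.ext ?_ (funext fun e => ?_)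
  · simp [Prod.fst_sum, genZ, hk]
  · rw [Prod.snd_sum, Finset.sum_apply]
    simp only [genZ, t, Pi.add_apply, Finset.sum_add_distrib]
    rw [ho e, Int.toNat_of_nonneg (sub_nonneg.2 (hle e))]
    ring
end

section
/- With K(α) = ∫_{ℝ₊ⁿ} t^{α̃}/(Σ_{a∈A} P_a t^{ã})^{α₀} dt/t (P_a > 0, A ⊂ ℤ^{n+1} finite with first coordinates 1), the function K, initially holomorphic for Re(α) in the interior of the cone C_A generated by A, extends to a meromorphic function on ℂ^{n+1} whose poles lie only on the hyperplanes {α : ⟨w_i, α⟩ = −m} for facet normals w_i of C_A and m ∈ ⟨w_i, Σ⟩ ⊆ ℤ_{≥0}, and the contiguity relation ⟨w, α⟩K(α) = α₀ Σ_{a∈A} ⟨w,a⟩ P_a K(α+a) holds identically. -/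
open MeasureTheory

/-- The candidate pole set of the continuation of `K`: the `-Σ` translates of the
hyperplanes `⟨w, α⟩ = 0` for the facet normals `w ∈ W`, where `Σ = ℕA` is the
semigroup generated by the points `(1, ã)`, `ã ∈ A`. -/
def poleSet (n : ℕ) (A : Finset (Fin n → ℤ)) (W : Finset (ℤ × (Fin n → ℤ))) :
    Set (ℂ × (Fin n → ℂ)) :=
  {α | ∃ w ∈ W, ∃ m ∈ AddSubmonoid.closure
      ((fun a : Fin n → ℤ => ((1 : ℤ), a)) '' (A : Set (Fin n → ℤ))),
    (w.1 : ℂ) * α.1 + ∑ i, (w.2 i : ℂ) * α.2 i =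
      -(((w.1 * m.1 + ∑ i, w.2 i * m.2 i : ℤ)) : ℂ)}


/-- Differentiation under the integral sign for exponential families: if
`exp (Re (ℓ x) α + r ‖ℓ x‖)` is integrable for some `r > 0`, then the Laplace-type integral
`β ↦ ∫ exp (ℓ x β)` is analytic at `α`. -/
theorem analyticAt_integral_cexp_of_integrable {X E : Type*} [MeasurableSpace X] {μ : Measure X}
    [NormedAddCommGroup E] [NormedSpace ℂ E] {ℓ : X → E →L[ℂ] ℂ}
    (hℓ : AEStronglyMeasurable ℓ μ) {α : E} {r : ℝ} (hr : 0 < r)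
    (hint : Integrable (fun x => Real.exp ((ℓ x α).re + r * ‖ℓ x‖)) μ) :
    AnalyticAt ℂ (fun β => ∫ x, Complex.exp (ℓ x β) ∂μ) α := by
  let g (k : ℕ) : ContinuousMultilinearMap ℂ (fun _ : Fin k => ℂ) ℂ :=
    ContinuousMultilinearMap.mkPiAlgebraFin ℂ k ℂ
  let c (k : ℕ) (x : X) : ContinuousMultilinearMap ℂ (fun _ : Fin k => E) ℂ :=
    (Complex.exp (ℓ x α) * ((k.factorial : ℂ)⁻¹)) •
      (g k).compContinuousLinearMap (fun _ => ℓ x)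
  have hev : AEStronglyMeasurable (fun x => ℓ x α) μ :=
    (ContinuousLinearMap.apply ℂ ℂ α).continuous.comp_aestronglyMeasurable hℓ
  have hcmeas (k : ℕ) : AEStronglyMeasurable (c k) μ := by
    have hcont : Continuous fun L : E →L[ℂ] ℂ => (g k).compContinuousLinearMap (fun _ => L) := by
      have h1 := (ContinuousMultilinearMap.compContinuousLinearMapContinuousMultilinear ℂ
        (fun _ : Fin k => E) (fun _ : Fin k => ℂ) ℂ).cont
      exact (ContinuousLinearMap.apply ℂ _ (g k)).continuous.comp
        (h1.comp (continuous_pi fun _ => continuous_id))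
    exact ((Complex.continuous_exp.comp_aestronglyMeasurable hev).mul_const _).smul
      (hcont.comp_aestronglyMeasurable hℓ)
  have hcnorm (k : ℕ) (x : X) :
      ‖c k x‖ ≤ Real.exp (ℓ x α).re * (‖ℓ x‖ ^ k / k.factorial) := by
    have h1 : ‖(g k).compContinuousLinearMap (fun _ => ℓ x)‖ ≤ ‖ℓ x‖ ^ k := by
      refine ((g k).norm_compContinuousLinearMap_le _).trans ?_
      simp [g, ContinuousMultilinearMap.norm_mkPiAlgebraFin]
    have h2 : ‖Complex.exp (ℓ x α) * ((k.factorial : ℂ)⁻¹)‖ =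
        Real.exp (ℓ x α).re * (k.factorial : ℝ)⁻¹ := by
      simp [Complex.norm_exp]
    simp only [c]
    rw [norm_smul, h2, div_eq_inv_mul, ← mul_assoc]
    gcongr
  have hbound (k : ℕ) (x : X) : ‖c k x‖ * r ^ k ≤
      Real.exp ((ℓ x α).re + r * ‖ℓ x‖) := by
    rw [Real.exp_add]
    calc ‖c k x‖ * r ^ k
        ≤ Real.exp (ℓ x α).re * (‖ℓ x‖ ^ k / k.factorial) * r ^ k := by
          gcongr; exact hcnorm k x
      _ = Real.exp (ℓ x α).re * ((r * ‖ℓ x‖) ^ k / k.factorial) := by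
          rw [mul_pow]; ring
      _ ≤ _ := by
          gcongr
          exact Real.pow_div_factorial_le_exp _ (by positivity) k
  have hcint (k : ℕ) : Integrable (c k) μ := by
    refine (hint.mul_const ((r ^ k)⁻¹)).mono' (hcmeas k) (Filter.Eventually.of_forall fun x => ?_)
    rw [← div_eq_mul_inv, le_div_iff₀ (by positivity)]
    exact hbound k x
  let p : FormalMultilinearSeries ℂ E ℂ := fun k => ∫ x, c k x ∂μ
  lift r to NNReal using hr.le
  refine HasFPowerSeriesAt.analyticAt (p := p) ⟨(r : ENNReal), ?_, by exact_mod_cast hr, ?_⟩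
  · refine p.le_radius_of_bound (∫ x, Real.exp ((ℓ x α).re + r * ‖ℓ x‖) ∂μ) fun k => ?_
    calc ‖p k‖ * (r : ℝ) ^ k ≤ (∫ x, ‖c k x‖ ∂μ) * (r : ℝ) ^ k := by
          gcongr; exact norm_integral_le_integral_norm _
      _ = ∫ x, ‖c k x‖ * (r : ℝ) ^ k ∂μ := (integral_mul_const _ _).symm
      _ ≤ _ := integral_mono ((hcint k).norm.mul_const _) hint (hbound k)
  · intro y hy
    have hyr : ‖y‖ ≤ r := by
      have : ‖y‖ < r := by simpa [enorm] using hy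
      exact this.le
    have hp (k : ℕ) : p k (fun _ => y) =
        ∫ x, Complex.exp (ℓ x α) * ((ℓ x y) ^ k / k.factorial) ∂μ := by
      simp only [p]
      rw [ContinuousMultilinearMap.integral_apply (hcint k)]
      refine integral_congr_ae (Filter.Eventually.of_forall fun x => ?_)
      simp [c, g]
      ring
    simp only [hp]
    have hle (x : X) : ‖ℓ x y‖ ≤ r * ‖ℓ x‖ := by
      rw [mul_comm]; exact ((ℓ x).le_opNorm y).trans (by gcongr)
    have hexp (x : X) : HasSum (fun k : ℕ => Real.exp (ℓ x α).re *
        ((r * ‖ℓ x‖) ^ k / k.factorial)) (Real.exp ((ℓ x α).re + r * ‖ℓ x‖)) := by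
      rw [Real.exp_add, Real.exp_eq_exp_ℝ]
      exact (NormedSpace.expSeries_div_hasSum_exp (𝔸 := ℝ) _).mul_left _
    refine hasSum_integral_of_dominated_convergence
      (fun k x => Real.exp (ℓ x α).re * ((r * ‖ℓ x‖) ^ k / k.factorial)) ?_ ?_ ?_ ?_ ?_
    · intro k
      have hy' : AEStronglyMeasurable (fun x => ℓ x y) μ :=
        (ContinuousLinearMap.apply ℂ ℂ y).continuous.comp_aestronglyMeasurable hℓ
      exact (Complex.continuous_exp.comp_aestronglyMeasurable hev).mul
        ((continuous_pow k).comp_aestronglyMeasurable hy' |>.mul_const _)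
    · refine fun k => Filter.Eventually.of_forall fun x => ?_
      rw [norm_mul, Complex.norm_exp, norm_div, norm_pow, Complex.norm_natCast]
      gcongr
      exact hle x
    · exact Filter.Eventually.of_forall fun x => (hexp x).summable
    · simp only [fun x => (hexp x).tsum_eq]
      exact hint
    · refine Filter.Eventually.of_forall fun x => ?_
      rw [map_add, Complex.exp_add, Complex.exp_eq_exp_ℂ]
      exact (NormedSpace.expSeries_div_hasSum_exp (𝔸 := ℂ) _).mul_left _

/-- The complexification `(1, ã)` of a point of the configuration. -/
noncomputable def liftPt {n : ℕ} (a : Fin n → ℤ) : ℂ × (Fin n → ℂ) := (1, fun i => (a i : ℂ))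

/-- The complexification of an integral covector. -/
noncomputable def castVec {n : ℕ} (w : ℤ × (Fin n → ℤ)) : ℂ × (Fin n → ℂ) :=
  ((w.1 : ℂ), fun i => (w.2 i : ℂ))

/-- The standard bilinear pairing on `ℂ^{n+1}`. -/
noncomputable def pairing {n : ℕ} (u α : ℂ × (Fin n → ℂ)) : ℂ :=
  u.1 * α.1 + ∑ i, u.2 i * α.2 i

theorem pairing_add {n : ℕ} (u α β : ℂ × (Fin n → ℂ)) :
    pairing u (α + β) = pairing u α + pairing u β := by
  simp only [pairing, Prod.fst_add, Prod.snd_add, Pi.add_apply, mul_add, Finset.sum_add_distrib]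
  ring

theorem continuous_pairing {n : ℕ} (u : ℂ × (Fin n → ℂ)) : Continuous (pairing u) := by
  unfold pairing; fun_prop

theorem analyticAt_pairing {n : ℕ} (u α : ℂ × (Fin n → ℂ)) : AnalyticAt ℂ (pairing u) α := by
  let L : (ℂ × (Fin n → ℂ)) →L[ℂ] ℂ := u.1 • ContinuousLinearMap.fst ℂ ℂ (Fin n → ℂ) +
    ∑ i, u.2 i • (ContinuousLinearMap.proj i).comp (ContinuousLinearMap.snd ℂ ℂ (Fin n → ℂ))
  have : pairing u = L := by
    ext β; simp [pairing, L]
  rw [this]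
  exact L.analyticAt α

theorem pairing_castVec_liftPt {n : ℕ} (w : ℤ × (Fin n → ℤ)) (a : Fin n → ℤ) :
    pairing (castVec w) (liftPt a) = ((w.1 + ∑ i, w.2 i * a i : ℤ) : ℂ) := by
  simp [pairing, castVec, liftPt]

theorem mem_poleSet_iff {n : ℕ} {A : Finset (Fin n → ℤ)} {W : Finset (ℤ × (Fin n → ℤ))}
    {α : ℂ × (Fin n → ℂ)} : α ∈ poleSet n A W ↔ ∃ w ∈ W, ∃ m ∈ AddSubmonoid.closure
      ((fun a : Fin n → ℤ => ((1 : ℤ), a)) '' (A : Set (Fin n → ℤ))),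
      pairing (castVec w) α = -(((w.1 * m.1 + ∑ i, w.2 i * m.2 i : ℤ)) : ℂ) := Iff.rfl

theorem pairing_ne_zero_of_notMem_poleSet {n : ℕ} {A : Finset (Fin n → ℤ)}
    {W : Finset (ℤ × (Fin n → ℤ))} {α : ℂ × (Fin n → ℂ)} (hα : α ∉ poleSet n A W)
    {w : ℤ × (Fin n → ℤ)} (hw : w ∈ W) : pairing (castVec w) α ≠ 0 := fun h =>
  hα (mem_poleSet_iff.2 ⟨w, hw, 0, zero_mem _, by simp [h]⟩)

theorem add_liftPt_notMem_poleSet {n : ℕ} {A : Finset (Fin n → ℤ)}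
    {W : Finset (ℤ × (Fin n → ℤ))} {α : ℂ × (Fin n → ℂ)} (hα : α ∉ poleSet n A W)
    {a : Fin n → ℤ} (ha : a ∈ A) : α + liftPt a ∉ poleSet n A W := by
  intro h
  obtain ⟨w, hw, m, hm, h⟩ := mem_poleSet_iff.1 h
  refine hα (mem_poleSet_iff.2 ⟨w, hw, m + (1, a),
    add_mem hm (AddSubmonoid.subset_closure ⟨a, ha, rfl⟩), ?_⟩)
  rw [pairing_add, pairing_castVec_liftPt] at h
  rw [eq_sub_of_add_eq h]
  simp only [Prod.fst_add, Prod.snd_add, Pi.add_apply, mul_add, Finset.sum_add_distrib]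
  push_cast
  ring

theorem isClosed_poleSet {n : ℕ} (A : Finset (Fin n → ℤ)) (W : Finset (ℤ × (Fin n → ℤ))) :
    IsClosed (poleSet n A W) := by
  have hcast : Topology.IsClosedEmbedding ((↑) : ℤ → ℂ) := by
    have h := Complex.isometry_ofReal.isClosedEmbedding.comp Real.isClosedEmbedding_intCast
    convert h using 1
    ext k; simp
  let S (w : ℤ × (Fin n → ℤ)) : Set ℤ := (fun m => -(w.1 * m.1 + ∑ i, w.2 i * m.2 i)) ''
    (AddSubmonoid.closure ((fun a : Fin n → ℤ => ((1 : ℤ), a)) '' (A : Set (Fin n → ℤ))) :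
      Set (ℤ × (Fin n → ℤ)))
  have : poleSet n A W = ⋃ w ∈ W, pairing (castVec w) ⁻¹' (((↑) : ℤ → ℂ) '' S w) := by
    ext α
    simp only [mem_poleSet_iff, Set.mem_iUnion, Set.mem_preimage, Set.mem_image, S,
      exists_exists_and_eq_and, exists_prop, SetLike.mem_coe]
    refine exists_congr fun w => and_congr_right fun _ => exists_congr fun m =>
      and_congr_right fun _ => ?_
    rw [Int.cast_neg]
    exact eq_comm
  rw [this]
  exact W.finite_toSet.isClosed_biUnion fun w _ =>
    (hcast.isClosedMap _ (isClosed_discrete _)).preimage (continuous_pairing _)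

/-- `G` is a continuation to the open set `D`, analytic off the candidate poles and satisfying
all contiguity relations there. -/
structure IsContinuation {n : ℕ} (A : Finset (Fin n → ℤ)) (P : (Fin n → ℤ) → ℝ)
    (W : Finset (ℤ × (Fin n → ℤ))) (D : Set (ℂ × (Fin n → ℂ))) (G : ℂ × (Fin n → ℂ) → ℂ) :
    Prop where
  isOpen : IsOpen D
  add_mem : ∀ α ∈ D, ∀ a ∈ A, α + liftPt a ∈ D
  analyticAt : ∀ α ∈ D, α ∉ poleSet n A W → AnalyticAt ℂ G α
  contiguity : ∀ α ∈ D, α ∉ poleSet n A W → ∀ u, pairing u α * G α =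
    α.1 * ∑ a ∈ A, pairing u (liftPt a) * P a * G (α + liftPt a)

/-- The set of points which every shift `a` with `⟨w, a⟩ ≠ 0` moves into `D`. -/
def shiftDomain {n : ℕ} (A : Finset (Fin n → ℤ)) (w : ℤ × (Fin n → ℤ))
    (D : Set (ℂ × (Fin n → ℂ))) : Set (ℂ × (Fin n → ℂ)) :=
  {α | ∀ a ∈ A, pairing (castVec w) (liftPt a) ≠ 0 → α + liftPt a ∈ D}

/-- The right-hand side of the contiguity relation for `w`, divided by `⟨w, α⟩`. -/
noncomputable def shiftFun {n : ℕ} (A : Finset (Fin n → ℤ)) (P : (Fin n → ℤ) → ℝ)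
    (w : ℤ × (Fin n → ℤ)) (G : ℂ × (Fin n → ℂ) → ℂ) (α : ℂ × (Fin n → ℂ)) : ℂ :=
  α.1 * (∑ a ∈ A, pairing (castVec w) (liftPt a) * P a * G (α + liftPt a)) /
    pairing (castVec w) α

namespace IsContinuation

variable {n : ℕ} {A : Finset (Fin n → ℤ)} {P : (Fin n → ℤ) → ℝ} {W : Finset (ℤ × (Fin n → ℤ))}
  {D : Set (ℂ × (Fin n → ℂ))} {G : ℂ × (Fin n → ℂ) → ℂ}

theorem subset_shiftDomain (h : IsContinuation A P W D G) (w : ℤ × (Fin n → ℤ)) :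
    D ⊆ shiftDomain A w D := fun α hα a ha _ => h.add_mem α hα a ha

theorem shiftFun_eq (h : IsContinuation A P W D G) {w : ℤ × (Fin n → ℤ)} (hw : w ∈ W)
    {α : ℂ × (Fin n → ℂ)} (hD : α ∈ D) (hα : α ∉ poleSet n A W) : shiftFun A P w G α = G α := by
  rw [shiftFun, ← h.contiguity α hD hα,
    mul_div_cancel_left₀ _ (pairing_ne_zero_of_notMem_poleSet hα hw)]

theorem analyticAt_shiftFun (h : IsContinuation A P W D G) {w : ℤ × (Fin n → ℤ)} (hw : w ∈ W)
    {α : ℂ × (Fin n → ℂ)} (hD : α ∈ shiftDomain A w D) (hα : α ∉ poleSet n A W) :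
    AnalyticAt ℂ (shiftFun A P w G) α := by
  refine ((analyticAt_fst).mul (Finset.analyticAt_fun_sum _ fun a ha => ?_)).div
    (analyticAt_pairing _ _) (pairing_ne_zero_of_notMem_poleSet hα hw)
  by_cases h0 : pairing (castVec w) (liftPt a) = 0
  · simp only [h0, zero_mul]
    exact analyticAt_const
  · refine analyticAt_const.mul (AnalyticAt.fun_comp (h.analyticAt _ (hD a ha h0)
      (add_liftPt_notMem_poleSet hα ha)) (analyticAt_id.add analyticAt_const))

theorem contiguity_shiftFun (h : IsContinuation A P W D G) {w : ℤ × (Fin n → ℤ)} (hw : w ∈ W)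
    {α : ℂ × (Fin n → ℂ)} (hD : α ∈ shiftDomain A w D) (hα : α ∉ poleSet n A W)
    (u : ℂ × (Fin n → ℂ)) : pairing u α * shiftFun A P w G α =
      α.1 * ∑ a ∈ A, pairing u (liftPt a) * P a * shiftFun A P w G (α + liftPt a) := by
  set pw := pairing (castVec w)
  have hw0 : pw α ≠ 0 := pairing_ne_zero_of_notMem_poleSet hα hw
  have hL (a) (ha : a ∈ A) : pairing u α * (pw (liftPt a) * P a * G (α + liftPt a)) =
      (∑ b ∈ A, (α.1 + 1) * (pw (liftPt a) * P a * (pairing u (liftPt b) * P b *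
        G (α + liftPt a + liftPt b)))) -
        pw (liftPt a) * pairing u (liftPt a) * P a * G (α + liftPt a) := by
    by_cases h0 : pw (liftPt a) = 0
    · simp [h0]
    · have hc := h.contiguity _ (hD a ha h0) (add_liftPt_notMem_poleSet hα ha) u
      rw [pairing_add] at hc
      simp only [← Finset.mul_sum]
      have h1 : (α + liftPt a).1 = α.1 + 1 := rfl
      rw [h1] at hc
      linear_combination pw (liftPt a) * P a * hc
  have hR (b) (hb : b ∈ A) :
      pw α * (pairing u (liftPt b) * P b * shiftFun A P w G (α + liftPt b)) =
      (∑ a ∈ A, (α.1 + 1) * (pw (liftPt a) * P a * (pairing u (liftPt b) * P b *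
        G (α + liftPt a + liftPt b)))) -
        pw (liftPt b) * pairing u (liftPt b) * P b * G (α + liftPt b) := by
    have hb' := add_liftPt_notMem_poleSet hα hb
    have h2 : pw (α + liftPt b) * shiftFun A P w G (α + liftPt b) =
        (α.1 + 1) * ∑ a ∈ A, pw (liftPt a) * P a * G (α + liftPt b + liftPt a) :=
      mul_div_cancel₀ _ (pairing_ne_zero_of_notMem_poleSet hb' hw)
    have h3 : pw (liftPt b) * shiftFun A P w G (α + liftPt b) =
        pw (liftPt b) * G (α + liftPt b) := by
      by_cases h0 : pw (liftPt b) = 0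
      · simp [h0]
      · rw [h.shiftFun_eq hw (hD b hb h0) hb']
    have h4 : (∑ a ∈ A, (α.1 + 1) * (pw (liftPt a) * P a * (pairing u (liftPt b) * P b *
        G (α + liftPt a + liftPt b)))) = pairing u (liftPt b) * P b *
        ((α.1 + 1) * ∑ a ∈ A, pw (liftPt a) * P a * G (α + liftPt b + liftPt a)) := by
      simp only [Finset.mul_sum]
      refine Finset.sum_congr rfl fun a _ => ?_
      rw [add_right_comm]; ring
    have h5 : pw (α + liftPt b) = pw α + pw (liftPt b) := pairing_add _ _ _
    rw [h4, ← h2, h5]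
    linear_combination -(pairing u (liftPt b) * P b) * h3
  have key : pairing u α * ∑ a ∈ A, pw (liftPt a) * P a * G (α + liftPt a) =
      pw α * ∑ b ∈ A, pairing u (liftPt b) * P b * shiftFun A P w G (α + liftPt b) := by
    rw [Finset.mul_sum, Finset.mul_sum, Finset.sum_congr rfl hL, Finset.sum_congr rfl hR,
      Finset.sum_sub_distrib, Finset.sum_sub_distrib, Finset.sum_comm]
  have h6 : shiftFun A P w G α =
    α.1 * (∑ a ∈ A, pw (liftPt a) * P a * G (α + liftPt a)) / pw α := rfl
  rw [h6, mul_div_assoc', div_eq_iff hw0]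
  linear_combination α.1 * key

theorem shift (h : IsContinuation A P W D G) {w : ℤ × (Fin n → ℤ)} (hw : w ∈ W) :
    IsContinuation A P W (shiftDomain A w D) (shiftFun A P w G) where
  isOpen := by
    have : shiftDomain A w D = ⋂ a ∈ A, {α | pairing (castVec w) (liftPt a) ≠ 0 →
        α + liftPt a ∈ D} := by
      ext; simp [shiftDomain]
    rw [this]
    refine isOpen_biInter_finset fun a _ => ?_
    by_cases h0 : pairing (castVec w) (liftPt a) = 0
    · simp [h0]
    · simp only [ne_eq, h0, not_false_eq_true, forall_const]
      exact h.isOpen.preimage (continuous_id.add continuous_const)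
  add_mem α hα b hb a ha h0 := by
    rw [add_right_comm]
    exact h.add_mem _ (hα a ha h0) b hb
  analyticAt _ hD hα := h.analyticAt_shiftFun hw hD hα
  contiguity _ hD hα u := h.contiguity_shiftFun hw hD hα u

end IsContinuation

/-- The region `Re ⟨w, α⟩ > -c(w)` for all `w ∈ W`. -/
def halfSpaces {n : ℕ} (W : Finset (ℤ × (Fin n → ℤ))) (c : ℤ × (Fin n → ℤ) → ℕ) :
    Set (ℂ × (Fin n → ℂ)) :=
  {α | ∀ w ∈ W, -(c w : ℝ) < (pairing (castVec w) α).re}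

theorem halfSpaces_subset_shiftDomain {n : ℕ} {A : Finset (Fin n → ℤ)}
    {W : Finset (ℤ × (Fin n → ℤ))} {D : Set (ℂ × (Fin n → ℂ))}
    (hWA : ∀ w ∈ W, ∀ a ∈ A, 0 ≤ w.1 + ∑ i, w.2 i * a i)
    {c c' : ℤ × (Fin n → ℤ) → ℕ} {w : ℤ × (Fin n → ℤ)} (hw : w ∈ W) (hcw : c' w ≤ c w + 1)
    (hc : ∀ v, v ≠ w → c' v ≤ c v) (hD : halfSpaces W c ⊆ D) :
    halfSpaces W c' ⊆ shiftDomain A w D := by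
  intro α hα a ha h0
  refine hD fun v hv => ?_
  have h1 := hα v hv
  have h2 := hWA v hv a ha
  rw [pairing_add, pairing_castVec_liftPt, Complex.add_re, Complex.intCast_re]
  rcases eq_or_ne v w with rfl | hne
  · rw [pairing_castVec_liftPt] at h0
    have h3 : v.1 + ∑ i, v.2 i * a i ≠ 0 := by exact_mod_cast h0
    have h4 : (1 : ℝ) ≤ ((v.1 + ∑ i, v.2 i * a i : ℤ) : ℝ) := by
      exact_mod_cast (by omega : 1 ≤ v.1 + ∑ i, v.2 i * a i)
    have h5 : (c' v : ℝ) ≤ c v + 1 := by exact_mod_cast hcw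
    linarith
  · have h4 : (0 : ℝ) ≤ ((v.1 + ∑ i, v.2 i * a i : ℤ) : ℝ) := by exact_mod_cast h2
    have h5 : (c' v : ℝ) ≤ c v := by exact_mod_cast hc v hne
    linarith

/-- A continuation extends across one more unit in all facet directions simultaneously. -/
theorem IsContinuation.exists_extension {n : ℕ} {A : Finset (Fin n → ℤ)} {P : (Fin n → ℤ) → ℝ}
    {W : Finset (ℤ × (Fin n → ℤ))} {D : Set (ℂ × (Fin n → ℂ))} {G : ℂ × (Fin n → ℂ) → ℂ}
    (h : IsContinuation A P W D G) (hWA : ∀ w ∈ W, ∀ a ∈ A, 0 ≤ w.1 + ∑ i, w.2 i * a i)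
    {N : ℕ} (hN : halfSpaces W (fun _ => N) ⊆ D) :
    ∃ D' G', IsContinuation A P W D' G' ∧ halfSpaces W (fun _ => N + 1) ⊆ D' ∧ D ⊆ D' ∧
      ∀ α ∈ D, α ∉ poleSet n A W → G' α = G α := by
  suffices H : ∀ S ⊆ W, ∃ D' G', IsContinuation A P W D' G' ∧
      halfSpaces W (fun w => if w ∈ S then N + 1 else N) ⊆ D' ∧ D ⊆ D' ∧
      ∀ α ∈ D, α ∉ poleSet n A W → G' α = G α by
    obtain ⟨D', G', h1, h2, h3⟩ := H W subset_rfl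
    refine ⟨D', G', h1, fun α hα => h2 fun w hw => ?_, h3⟩
    simpa [hw] using hα w hw
  intro S
  induction S using Finset.induction_on with
  | empty => exact fun _ => ⟨D, G, h, by simpa using hN, subset_rfl, fun _ _ _ => rfl⟩
  | insert w S hwS ih =>
    intro hS
    obtain ⟨D', G', h1, h2, h3, h4⟩ := ih ((Finset.subset_insert _ _).trans hS)
    have hw : w ∈ W := hS (Finset.mem_insert_self _ _)
    refine ⟨_, _, h1.shift hw, halfSpaces_subset_shiftDomain hWA hw ?_ ?_ h2,
      h3.trans (h1.subset_shiftDomain w), fun α hD hα => ?_⟩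
    · simp [hwS]
    · intro v hv
      simp [Finset.mem_insert, hv]
    · rw [h1.shiftFun_eq hw (h3 hD) hα, h4 α hD hα]

/-- A continuation on the domain `Re ⟨w, α⟩ > 0` extends to the whole space. -/
theorem IsContinuation.exists_global {n : ℕ} {A : Finset (Fin n → ℤ)} {P : (Fin n → ℤ) → ℝ}
    {W : Finset (ℤ × (Fin n → ℤ))} {G : ℂ × (Fin n → ℂ) → ℂ}
    (h : IsContinuation A P W (halfSpaces W 0) G)
    (hWA : ∀ w ∈ W, ∀ a ∈ A, 0 ≤ w.1 + ∑ i, w.2 i * a i) :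
    ∃ F, IsContinuation A P W Set.univ F ∧
      ∀ α ∈ halfSpaces W 0, α ∉ poleSet n A W → F α = G α := by
  let T := {x : ℕ × Set (ℂ × (Fin n → ℂ)) × (ℂ × (Fin n → ℂ) → ℂ) //
    IsContinuation A P W x.2.1 x.2.2 ∧ halfSpaces W (fun _ => x.1) ⊆ x.2.1}
  have hstep (x : T) : ∃ y : T, y.1.1 = x.1.1 + 1 ∧ x.1.2.1 ⊆ y.1.2.1 ∧
      ∀ α ∈ x.1.2.1, α ∉ poleSet n A W → y.1.2.2 α = x.1.2.2 α := by
    obtain ⟨D', G', h1, h2, h3⟩ := x.2.1.exists_extension hWA x.2.2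
    exact ⟨⟨(x.1.1 + 1, D', G'), h1, h2⟩, rfl, h3⟩
  choose next hnext using hstep
  let s (k : ℕ) : T := next^[k] ⟨(0, halfSpaces W 0, G), h, subset_rfl⟩
  have hs (k : ℕ) : s (k + 1) = next (s k) := Function.iterate_succ_apply' _ _ _
  let D (k : ℕ) := (s k).1.2.1
  let g (k : ℕ) := (s k).1.2.2
  have hlev (k : ℕ) : (s k).1.1 = k := by
    induction k with
    | zero => rfl
    | succ k ih => rw [hs, (hnext _).1, ih]
  have hgood (k : ℕ) : IsContinuation A P W (D k) (g k) := (s k).2.1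
  have hDmono : Monotone D := monotone_nat_of_le_succ fun k => by
    simp only [D, hs]
    exact (hnext _).2.1
  have hg (k j : ℕ) (hkj : k ≤ j) (α) (hD : α ∈ D k) (hα : α ∉ poleSet n A W) :
      g j α = g k α := by
    induction j, hkj using Nat.le_induction with
    | base => rfl
    | succ j hkj ih =>
      rw [← ih]
      simp only [g, hs]
      exact (hnext _).2.2 α (hDmono hkj hD) hα
  have hcover (α : ℂ × (Fin n → ℂ)) : ∃ k, α ∈ D k := by
    obtain ⟨k, hk⟩ := exists_nat_gt (∑ w ∈ W, |(pairing (castVec w) α).re|)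
    refine ⟨k, (s k).2.2 fun w hw => ?_⟩
    have h1 := Finset.single_le_sum (f := fun w => |(pairing (castVec w) α).re|)
      (fun _ _ => abs_nonneg _) hw
    have h2 := neg_abs_le (pairing (castVec w) α).re
    rw [hlev]
    linarith
  choose κ hκ using hcover
  let F (α : ℂ × (Fin n → ℂ)) : ℂ := g (κ α) α
  have hF (k : ℕ) (α) (hD : α ∈ D k) (hα : α ∉ poleSet n A W) : F α = g k α := by
    rcases le_total k (κ α) with hle | hle
    · exact hg _ _ hle α hD hα
    · exact (hg _ _ hle α (hκ α) hα).symm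
  refine ⟨F, ⟨isOpen_univ, fun _ _ _ _ => trivial, fun α _ hα => ?_, fun α _ hα u => ?_⟩,
    fun α hD hα => hF 0 α hD hα⟩
  · refine ((hgood (κ α)).analyticAt α (hκ α) hα).congr ?_
    filter_upwards [(hgood (κ α)).isOpen.mem_nhds (hκ α),
      (isClosed_poleSet A W).isOpen_compl.mem_nhds hα] with β h1 h2
    exact (hF _ β h1 h2).symm
  · rw [hF _ α (hκ α) hα, (hgood (κ α)).contiguity α (hκ α) hα u]
    congr 1
    refine Finset.sum_congr rfl fun a ha => ?_
    rw [hF _ _ ((hgood (κ α)).add_mem α (hκ α) a ha) (add_liftPt_notMem_poleSet hα ha)]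

/-- The polynomial `Σ P_a t^{ã}` in logarithmic coordinates `t = exp x`. -/
noncomputable def polyExp {n : ℕ} (A : Finset (Fin n → ℤ)) (P : (Fin n → ℤ) → ℝ)
    (x : Fin n → ℝ) : ℝ :=
  ∑ a ∈ A, P a * Real.exp (∑ i, (a i : ℝ) * x i)

theorem polyExp_pos {n : ℕ} {A : Finset (Fin n → ℤ)} {P : (Fin n → ℤ) → ℝ}
    (hP : ∀ a ∈ A, 0 < P a) (hA : A.Nonempty) (x : Fin n → ℝ) : 0 < polyExp A P x :=
  Finset.sum_pos (fun a ha => mul_pos (hP a ha) (Real.exp_pos _)) hA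

theorem continuous_polyExp {n : ℕ} (A : Finset (Fin n → ℤ)) (P : (Fin n → ℤ) → ℝ) :
    Continuous (polyExp A P) := by
  unfold polyExp; fun_prop

/-- The linear form `α ↦ ⟨α̃, x⟩ - α₀ log (Σ P_a e^{⟨ã, x⟩})`, whose exponential is the
integrand in logarithmic coordinates. -/
noncomputable def logForm {n : ℕ} (A : Finset (Fin n → ℤ)) (P : (Fin n → ℤ) → ℝ)
    (x : Fin n → ℝ) : (ℂ × (Fin n → ℂ)) →L[ℂ] ℂ :=
  (-(Real.log (polyExp A P x) : ℂ)) • ContinuousLinearMap.fst ℂ ℂ (Fin n → ℂ) +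
    ∑ i, (x i : ℂ) • (ContinuousLinearMap.proj (R := ℂ) (φ := fun _ : Fin n => ℂ) i).comp
      (ContinuousLinearMap.snd ℂ ℂ (Fin n → ℂ))

theorem logForm_apply {n : ℕ} (A : Finset (Fin n → ℤ)) (P : (Fin n → ℤ) → ℝ)
    (x : Fin n → ℝ) (α : ℂ × (Fin n → ℂ)) :
    logForm A P x α = -(Real.log (polyExp A P x) : ℂ) * α.1 + ∑ i, (x i : ℂ) * α.2 i := by
  simp [logForm]

theorem logForm_re {n : ℕ} (A : Finset (Fin n → ℤ)) (P : (Fin n → ℤ) → ℝ)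
    (x : Fin n → ℝ) (α : ℂ × (Fin n → ℂ)) :
    (logForm A P x α).re = -Real.log (polyExp A P x) * α.1.re + ∑ i, x i * (α.2 i).re := by
  rw [logForm_apply, ← Complex.ofReal_neg]
  simp only [Complex.add_re, Complex.re_sum, Complex.re_ofReal_mul]

theorem norm_logForm_le {n : ℕ} (A : Finset (Fin n → ℤ)) (P : (Fin n → ℤ) → ℝ)
    (x : Fin n → ℝ) : ‖logForm A P x‖ ≤ |Real.log (polyExp A P x)| + ∑ i, |x i| := by
  refine ContinuousLinearMap.opNorm_le_bound _ (by positivity) fun α => ?_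
  rw [logForm_apply, add_mul, Finset.sum_mul]
  refine (norm_add_le _ _).trans (add_le_add ?_ ((norm_sum_le _ _).trans
    (Finset.sum_le_sum fun i _ => ?_)))
  · rw [norm_mul, norm_neg, Complex.norm_real, Real.norm_eq_abs]
    gcongr
    exact norm_fst_le α
  · rw [norm_mul, Complex.norm_real, Real.norm_eq_abs]
    gcongr
    exact (norm_le_pi_norm _ i).trans (norm_snd_le α)

theorem continuous_logForm {n : ℕ} {A : Finset (Fin n → ℤ)} {P : (Fin n → ℤ) → ℝ}
    (hP : ∀ a ∈ A, 0 < P a) (hA : A.Nonempty) : Continuous (logForm A P) := by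
  have h1 : Continuous fun x => Real.log (polyExp A P x) :=
    (continuous_polyExp A P).log fun x => (polyExp_pos hP hA x).ne'
  unfold logForm
  refine ((Complex.continuous_ofReal.comp h1).neg.smul continuous_const).add
    (continuous_finsetSum _ fun i _ => ?_)
  exact (Complex.continuous_ofReal.comp (continuous_apply i)).smul continuous_const

theorem exp_logForm_liftPt {n : ℕ} {A : Finset (Fin n → ℤ)} {P : (Fin n → ℤ) → ℝ}
    (hP : ∀ a ∈ A, 0 < P a) (hA : A.Nonempty) (x : Fin n → ℝ) (a : Fin n → ℤ) :
    Complex.exp (logForm A P x (liftPt a)) =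
      ((Real.exp (∑ i, (a i : ℝ) * x i) / polyExp A P x : ℝ) : ℂ) := by
  have h : logForm A P x (liftPt a) =
      ((∑ i, (a i : ℝ) * x i - Real.log (polyExp A P x) : ℝ) : ℂ) := by
    rw [logForm_apply]
    simp only [liftPt]
    push_cast
    simp only [mul_comm (x _ : ℂ)]
    ring
  rw [h, ← Complex.ofReal_exp, Real.exp_sub, Real.exp_log (polyExp_pos hP hA x)]

theorem sum_mul_exp_logForm_liftPt {n : ℕ} {A : Finset (Fin n → ℤ)} {P : (Fin n → ℤ) → ℝ}
    (hP : ∀ a ∈ A, 0 < P a) (hA : A.Nonempty) (x : Fin n → ℝ) :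
    ∑ a ∈ A, (P a : ℂ) * Complex.exp (logForm A P x (liftPt a)) = 1 := by
  have h : ∑ a ∈ A, P a * (Real.exp (∑ i, (a i : ℝ) * x i) / polyExp A P x) = 1 := by
    simp only [← mul_div_assoc]
    rw [← Finset.sum_div]
    exact div_self (polyExp_pos hP hA x).ne'
  simp only [exp_logForm_liftPt hP hA]
  exact_mod_cast h

theorem logForm_le_of_mem_coneA {n : ℕ} {A : Finset (Fin n → ℤ)} {P : (Fin n → ℤ) → ℝ}
    (hP : ∀ a ∈ A, 0 < P a) {ρ : ℝ × (Fin n → ℝ)} (hρ : ρ ∈ coneA n A) (x : Fin n → ℝ) :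
    -Real.log (polyExp A P x) * ρ.1 + ∑ i, x i * ρ.2 i ≤ ρ.1 * ∑ a ∈ A, |Real.log (P a)| := by
  obtain ⟨c, hc, rfl⟩ := hρ
  have h (a) (ha : a ∈ A) : ∑ i, (a i : ℝ) * x i - Real.log (polyExp A P x) ≤
      ∑ a ∈ A, |Real.log (P a)| := by
    have h1 : P a * Real.exp (∑ i, (a i : ℝ) * x i) ≤ polyExp A P x :=
      Finset.single_le_sum (f := fun a => P a * Real.exp (∑ i, (a i : ℝ) * x i))
        (fun b hb => (mul_pos (hP b hb) (Real.exp_pos _)).le) ha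
    have h2 := Real.log_le_log (mul_pos (hP a ha) (Real.exp_pos _)) h1
    rw [Real.log_mul (hP a ha).ne' (Real.exp_pos _).ne', Real.log_exp] at h2
    have h3 := Finset.single_le_sum (f := fun a => |Real.log (P a)|)
      (fun _ _ => abs_nonneg _) ha
    have h4 := neg_abs_le (Real.log (P a))
    linarith
  have h5 : ∑ i, x i * ∑ a ∈ A, c a * (a i : ℝ) = ∑ a ∈ A, c a * ∑ i, (a i : ℝ) * x i := by
    simp only [Finset.mul_sum]
    rw [Finset.sum_comm]
    exact Finset.sum_congr rfl fun a _ => Finset.sum_congr rfl fun i _ => by ring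
  simp only [Prod.fst_sum, Prod.snd_sum, Prod.smul_mk, Finset.sum_apply, Pi.smul_apply,
    smul_eq_mul, mul_one]
  rw [h5, Finset.sum_mul, Finset.mul_sum, ← Finset.sum_add_distrib]
  refine Finset.sum_le_sum fun a ha => ?_
  nlinarith [mul_le_mul_of_nonneg_left (h a ha) (hc a)]

theorem exists_logForm_le_of_mem_interior {n : ℕ} {A : Finset (Fin n → ℤ)}
    {P : (Fin n → ℤ) → ℝ} (hP : ∀ a ∈ A, 0 < P a) {σ : ℝ × (Fin n → ℝ)}
    (hσ : σ ∈ interior (coneA n A)) : ∃ r > 0, ∃ C, ∀ x : Fin n → ℝ,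
      -Real.log (polyExp A P x) * σ.1 + ∑ i, x i * σ.2 i ≤
        C - r * (|Real.log (polyExp A P x)| + ∑ i, |x i|) := by
  obtain ⟨ε, hε, hball⟩ := Metric.mem_nhds_iff.1 (mem_interior_iff_mem_nhds.1 hσ)
  have hsign (y : ℝ) : |(SignType.sign y : ℝ)| ≤ 1 := by
    rcases lt_trichotomy y 0 with h | h | h <;> simp [h]
  refine ⟨ε / 2, by positivity, (σ.1 + ε / 2) * ∑ a ∈ A, |Real.log (P a)|, fun x => ?_⟩
  set L := Real.log (polyExp A P x)
  let ρ : ℝ × (Fin n → ℝ) := (σ.1 + ε / 2 * SignType.sign (-L),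
    fun i => σ.2 i + ε / 2 * SignType.sign (x i))
  have hbd (y : ℝ) : |ε / 2 * (SignType.sign y : ℝ)| ≤ ε / 2 := by
    rw [abs_mul, abs_of_pos (half_pos hε)]
    exact mul_le_of_le_one_right (half_pos hε).le (hsign y)
  have hρ : ρ ∈ coneA n A := by
    refine hball (Metric.mem_ball.2 (lt_of_le_of_lt ?_ (half_lt_self hε)))
    rw [Prod.dist_eq]
    refine max_le ?_ ((dist_pi_le_iff (half_pos hε).le).2 fun i => ?_)
    · rw [Real.dist_eq, add_sub_cancel_left]; exact hbd (-L)
    · rw [Real.dist_eq, add_sub_cancel_left]; exact hbd (x i)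
  have h1 := logForm_le_of_mem_coneA hP hρ x
  have h2 : (σ.1 + ε / 2 * (SignType.sign (-L) : ℝ)) * ∑ a ∈ A, |Real.log (P a)| ≤
      (σ.1 + ε / 2) * ∑ a ∈ A, |Real.log (P a)| :=
    mul_le_mul_of_nonneg_right (by linarith [(le_abs_self _).trans (hbd (-L))])
      (Finset.sum_nonneg fun _ _ => abs_nonneg _)
  have h3 : ∑ i, x i * ρ.2 i = ∑ i, x i * σ.2 i + ε / 2 * ∑ i, |x i| := by
    rw [Finset.mul_sum, ← Finset.sum_add_distrib]
    refine Finset.sum_congr rfl fun i _ => ?_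
    rw [← self_mul_sign (x i)]
    simp only [ρ]
    ring
  have h4 : -L * ρ.1 = -L * σ.1 + ε / 2 * |L| := by
    rw [← abs_neg L, ← self_mul_sign (-L)]
    simp only [ρ]
    ring
  change -L * ρ.1 + _ ≤ (σ.1 + ε / 2 * (SignType.sign (-L) : ℝ)) * _ at h1
  rw [h3, h4] at h1
  linarith

theorem nonempty_of_mem_interior_coneA {n : ℕ} {A : Finset (Fin n → ℤ)} {σ : ℝ × (Fin n → ℝ)}
    (hσ : σ ∈ interior (coneA n A)) : A.Nonempty := by
  by_contra h
  rw [Finset.not_nonempty_iff_eq_empty] at h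
  subst h
  have : coneA n ∅ ⊆ {0} := by rintro x ⟨c, -, rfl⟩; simp
  have h2 := interior_mono this hσ
  rw [interior_singleton] at h2
  exact h2

theorem integrable_exp_neg_mul_abs {r : ℝ} (hr : 0 < r) :
    Integrable fun x : ℝ => Real.exp (-(r * |x|)) := by
  rw [← integrableOn_univ, ← Set.Iic_union_Ioi (a := (0 : ℝ)), integrableOn_union]
  refine ⟨(integrableOn_exp_mul_Iic hr 0).congr_fun (fun x hx => ?_) measurableSet_Iic,
    (integrableOn_exp_mul_Ioi (neg_neg_of_pos hr) 0).congr_fun (fun x hx => ?_)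
      measurableSet_Ioi⟩
  · simp [abs_of_nonpos (Set.mem_Iic.1 hx)]
  · simp [abs_of_pos (Set.mem_Ioi.1 hx)]

/-- The point of `ℝ^{n+1}` formed by the real parts. -/
noncomputable def rePart {n : ℕ} (α : ℂ × (Fin n → ℂ)) : ℝ × (Fin n → ℝ) :=
  (α.1.re, fun i => (α.2 i).re)

theorem exists_integrable_exp_logForm {n : ℕ} {A : Finset (Fin n → ℤ)} {P : (Fin n → ℤ) → ℝ}
    (hP : ∀ a ∈ A, 0 < P a) {α : ℂ × (Fin n → ℂ)} (hα : rePart α ∈ interior (coneA n A)) :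
    ∃ r > 0, Integrable fun x => Real.exp ((logForm A P x α).re + r * ‖logForm A P x‖) := by
  obtain ⟨r, hr, C, hC⟩ := exists_logForm_le_of_mem_interior hP hα
  have hA := nonempty_of_mem_interior_coneA hα
  have hprod : Integrable fun x : Fin n → ℝ => Real.exp C * ∏ i, Real.exp (-(r / 2 * |x i|)) :=
    (Integrable.fintype_prod (f := fun (_ : Fin n) y => Real.exp (-(r / 2 * |y|)))
      fun _ => integrable_exp_neg_mul_abs (half_pos hr)).const_mul _
  have hcont := continuous_logForm hP hA
  refine ⟨r / 2, half_pos hr, hprod.mono' ?_ (Filter.Eventually.of_forall fun x => ?_)⟩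
  · refine Continuous.aestronglyMeasurable (Real.continuous_exp.comp ?_)
    exact (Complex.continuous_re.comp (hcont.clm_apply continuous_const)).add
      (continuous_const.mul hcont.norm)
  · rw [Real.norm_eq_abs, Real.abs_exp, ← Real.exp_sum, ← Real.exp_add, Real.exp_le_exp,
      logForm_re, Finset.sum_neg_distrib, ← Finset.mul_sum]
    have h1 := hC x
    have h2 := mul_le_mul_of_nonneg_left (norm_logForm_le A P x) (half_pos hr).le
    have h3 : 0 ≤ |Real.log (polyExp A P x)| := abs_nonneg _
    simp only [rePart] at h1
    nlinarith

/-- The integral `K(α)` in logarithmic coordinates. -/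
noncomputable def logIntegral {n : ℕ} (A : Finset (Fin n → ℤ)) (P : (Fin n → ℤ) → ℝ)
    (α : ℂ × (Fin n → ℂ)) : ℂ :=
  ∫ x, Complex.exp (logForm A P x α)

theorem analyticAt_logIntegral {n : ℕ} {A : Finset (Fin n → ℤ)} {P : (Fin n → ℤ) → ℝ}
    (hP : ∀ a ∈ A, 0 < P a) {α : ℂ × (Fin n → ℂ)} (hα : rePart α ∈ interior (coneA n A)) :
    AnalyticAt ℂ (logIntegral A P) α := by
  obtain ⟨r, hr, hint⟩ := exists_integrable_exp_logForm hP hα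
  exact analyticAt_integral_cexp_of_integrable (continuous_logForm hP
    (nonempty_of_mem_interior_coneA hα)).aestronglyMeasurable hr hint

theorem integrable_cexp_logForm {n : ℕ} {A : Finset (Fin n → ℤ)} {P : (Fin n → ℤ) → ℝ}
    (hP : ∀ a ∈ A, 0 < P a) {α : ℂ × (Fin n → ℂ)} (hα : rePart α ∈ interior (coneA n A)) :
    Integrable fun x => Complex.exp (logForm A P x α) := by
  obtain ⟨r, hr, hint⟩ := exists_integrable_exp_logForm hP hα
  have hcont := continuous_logForm hP (nonempty_of_mem_interior_coneA hα)
  refine hint.mono' (Complex.continuous_exp.comp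
    (hcont.clm_apply continuous_const)).aestronglyMeasurable
    (Filter.Eventually.of_forall fun x => ?_)
  rw [Complex.norm_exp, Real.exp_le_exp]
  have : 0 ≤ r * ‖logForm A P x‖ := by positivity
  linarith

theorem toricIntegrand_exp {n : ℕ} {A : Finset (Fin n → ℤ)} {P : (Fin n → ℤ) → ℝ}
    (hP : ∀ a ∈ A, 0 < P a) (hA : A.Nonempty) (α : ℂ × (Fin n → ℂ)) (x : Fin n → ℝ) :
    |∏ i, Real.exp (x i)| • toricIntegrand n A P α.1 α.2 (fun i => Real.exp (x i)) =
      Complex.exp (logForm A P x α) := by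
  have hpoly : ∑ a ∈ A, P a * ∏ i, Real.exp (x i) ^ (a i) = polyExp A P x := by
    refine Finset.sum_congr rfl fun a _ => ?_
    rw [Real.exp_sum]
    simp only [← Real.rpow_intCast, ← Real.exp_mul, mul_comm]
  have hpow {y : ℝ} (hy : 0 < y) (z : ℂ) : (y : ℂ) ^ z = Complex.exp (Real.log y * z) := by
    rw [Complex.cpow_def_of_ne_zero (by exact_mod_cast hy.ne'), Complex.ofReal_log hy.le]
  have hne : ∏ i, (Real.exp (x i) : ℂ) ≠ 0 :=
    Finset.prod_ne_zero_iff.2 fun i _ => by exact_mod_cast (Real.exp_pos _).ne'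
  rw [toricIntegrand, hpoly, abs_of_pos (Finset.prod_pos fun i _ => Real.exp_pos _),
    Complex.real_smul, Complex.ofReal_prod, mul_div_assoc', mul_comm, mul_div_mul_right _ _ hne,
    hpow (polyExp_pos hP hA x)]
  simp only [hpow (Real.exp_pos _), Real.log_exp]
  rw [← Complex.exp_sum, ← Complex.exp_sub, logForm_apply]
  congr 1
  ring

theorem Kint_eq_logIntegral {n : ℕ} {A : Finset (Fin n → ℤ)} {P : (Fin n → ℤ) → ℝ}
    (hP : ∀ a ∈ A, 0 < P a) (hA : A.Nonempty) (α : ℂ × (Fin n → ℂ)) :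
    Kint n A P α.1 α.2 = logIntegral A P α := by
  let f (x : Fin n → ℝ) (i : Fin n) : ℝ := Real.exp (x i)
  let f' (x : Fin n → ℝ) : (Fin n → ℝ) →L[ℝ] (Fin n → ℝ) :=
    ContinuousLinearMap.pi fun i =>
      ((Real.exp (x i)) • ContinuousLinearMap.id ℝ ℝ).comp (ContinuousLinearMap.proj i)
  have hf' (x) : HasFDerivAt f (f' x) x := by
    refine hasFDerivAt_pi.2 fun i => ?_
    have := (ContinuousLinearMap.proj (R := ℝ) (φ := fun _ : Fin n => ℝ) i).hasFDerivAt (x := x)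
    exact this.exp
  have himg : f '' Set.univ = {t | ∀ i, 0 < t i} := by
    ext t
    simp only [Set.image_univ, Set.mem_range, Set.mem_ofPred_eq]
    refine ⟨?_, fun h => ⟨fun i => Real.log (t i), funext fun i => Real.exp_log (h i)⟩⟩
    rintro ⟨x, rfl⟩ i
    exact Real.exp_pos _
  have hinj : Set.InjOn f Set.univ := fun x _ y _ h =>
    funext fun i => Real.exp_injective (congrFun h i)
  rw [Kint, ← himg, integral_image_eq_integral_abs_det_fderiv_smul volume MeasurableSet.univ
    (fun x _ => (hf' x).hasFDerivWithinAt) hinj, Measure.restrict_univ, logIntegral]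
  refine integral_congr_ae (Filter.Eventually.of_forall fun x => ?_)
  have hdet : (f' x).det = ∏ i, Real.exp (x i) := by
    rw [ContinuousLinearMap.det_pi]
    simp [ContinuousLinearMap.det]
  simp only [hdet]
  exact toricIntegrand_exp hP hA α x

theorem hasLineDerivAt_cexp_logForm {n : ℕ} {A : Finset (Fin n → ℤ)} {P : (Fin n → ℤ) → ℝ}
    (hP : ∀ a ∈ A, 0 < P a) (hA : A.Nonempty) (α : ℂ × (Fin n → ℂ)) (j : Fin n)
    (x : Fin n → ℝ) :
    HasLineDerivAt ℝ (fun x => Complex.exp (logForm A P x α))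
      (α.2 j * Complex.exp (logForm A P x α) -
        α.1 * ∑ a ∈ A, (a j : ℂ) * P a * Complex.exp (logForm A P x (α + liftPt a)))
      x (Pi.single j 1) := by
  set v : Fin n → ℝ := Pi.single j 1 with hv
  have hpos := polyExp_pos hP hA x
  have hx (i : Fin n) : HasDerivAt (fun t : ℝ => (x + t • v) i)
      (v i) 0 := by
    simpa using ((hasDerivAt_id (0 : ℝ)).mul_const
      (v i)).const_add (x i)
  have hpoly : HasDerivAt (fun t : ℝ => polyExp A P (x + t • v))
      (∑ a ∈ A, P a * (Real.exp (∑ i, (a i : ℝ) * x i) * a j)) 0 := by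
    refine HasDerivAt.fun_sum fun a _ => ?_
    have h1 := (HasDerivAt.fun_sum (u := Finset.univ) fun i _ =>
      (hx i).const_mul (a i : ℝ)).exp.const_mul (P a)
    simpa [hv, Pi.single_apply] using h1
  have hlog := (hpoly.log (by simpa using hpos.ne')).ofReal_comp
  have hlin : HasDerivAt (fun t : ℝ => ∑ i, (((x + t • v) i : ℝ) : ℂ) * α.2 i)
      (α.2 j) 0 := by
    have h1 := HasDerivAt.fun_sum (u := Finset.univ) fun i _ =>
      (hx i).ofReal_comp.mul_const (α.2 i)
    convert! h1 using 1
    simp [hv, Pi.single_apply, apply_ite Complex.ofReal]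
  have hmain := ((hlog.neg.mul_const α.1).add hlin).cexp
  unfold HasLineDerivAt
  simp only [logForm_apply A P _ α]
  convert! hmain using 1
  simp only [map_add, Complex.exp_add, exp_logForm_liftPt hP hA, zero_smul, add_zero,
    logForm_apply A P _ α]
  have h2 : ((∑ a ∈ A, P a * (Real.exp (∑ i, (a i : ℝ) * x i) * a j)) / polyExp A P x : ℝ) =
      ∑ a ∈ A, a j * P a * (Real.exp (∑ i, (a i : ℝ) * x i) / polyExp A P x) := by
    rw [Finset.sum_div]
    exact Finset.sum_congr rfl fun a _ => by ring
  have h3 : (((∑ a ∈ A, P a * (Real.exp (∑ i, (a i : ℝ) * x i) * a j)) / polyExp A P x : ℝ) : ℂ) =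
      ∑ a ∈ A, (a j : ℂ) * P a * ((Real.exp (∑ i, (a i : ℝ) * x i) / polyExp A P x : ℝ) : ℂ) := by
    rw [h2]; push_cast; rfl
  rw [h3]
  have h4 (z : ℂ) (q : (Fin n → ℤ) → ℂ) : ∑ a ∈ A, (a j : ℂ) * P a * (z * q a) =
      z * ∑ a ∈ A, (a j : ℂ) * P a * q a := by
    rw [Finset.mul_sum]
    exact Finset.sum_congr rfl fun a _ => by ring
  rw [h4]
  simp only [Pi.add_apply, Pi.neg_apply, Pi.zero_apply, zero_smul, add_zero, Complex.exp_add]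
  ring

theorem logIntegral_contiguity_coord {n : ℕ} {A : Finset (Fin n → ℤ)} {P : (Fin n → ℤ) → ℝ}
    (hP : ∀ a ∈ A, 0 < P a) {α : ℂ × (Fin n → ℂ)} (hα : rePart α ∈ interior (coneA n A))
    (hαA : ∀ a ∈ A, rePart (α + liftPt a) ∈ interior (coneA n A)) (j : Fin n) :
    α.2 j * logIntegral A P α =
      α.1 * ∑ a ∈ A, (a j : ℂ) * P a * logIntegral A P (α + liftPt a) := by
  have hA := nonempty_of_mem_interior_coneA hα
  have h1 : Integrable fun x => α.2 j * Complex.exp (logForm A P x α) :=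
    (integrable_cexp_logForm hP hα).const_mul _
  have h2 (a) (ha : a ∈ A) : Integrable fun x =>
      (a j : ℂ) * P a * Complex.exp (logForm A P x (α + liftPt a)) :=
    (integrable_cexp_logForm hP (hαA a ha)).const_mul _
  have h3 := (integrable_finsetSum A h2).const_mul α.1
  have h4 := integral_bilinear_hasLineDerivAt_right_eq_neg_left_of_integrable
    (μ := (volume : Measure (Fin n → ℝ))) (B := ContinuousLinearMap.mul ℝ ℂ)
    (f := fun _ => 1) (f' := fun _ => 0) (v := Pi.single j 1) (by simp)
    (by simpa only [ContinuousLinearMap.mul_apply', one_mul] using! h1.sub h3)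
    (by simpa using integrable_cexp_logForm hP hα)
    (fun x _ => by unfold HasLineDerivAt; exact hasDerivAt_const _ _)
    (fun x _ => hasLineDerivAt_cexp_logForm hP hA α j x)
  simp only [ContinuousLinearMap.mul_apply', one_mul, zero_mul, integral_zero, neg_zero] at h4
  rw [integral_sub h1 h3, integral_const_mul, integral_const_mul, integral_finsetSum A h2,
    sub_eq_zero] at h4
  simpa only [logIntegral, integral_const_mul] using h4

theorem logIntegral_eq_sum {n : ℕ} {A : Finset (Fin n → ℤ)} {P : (Fin n → ℤ) → ℝ}
    (hP : ∀ a ∈ A, 0 < P a) {α : ℂ × (Fin n → ℂ)} (hα : rePart α ∈ interior (coneA n A))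
    (hαA : ∀ a ∈ A, rePart (α + liftPt a) ∈ interior (coneA n A)) :
    logIntegral A P α = ∑ a ∈ A, (P a : ℂ) * logIntegral A P (α + liftPt a) := by
  have hA := nonempty_of_mem_interior_coneA hα
  simp only [logIntegral, ← integral_const_mul]
  rw [← integral_finsetSum A fun a ha => (integrable_cexp_logForm hP (hαA a ha)).const_mul _]
  refine integral_congr_ae (Filter.Eventually.of_forall fun x => ?_)
  simp only [map_add, Complex.exp_add, mul_left_comm (P _ : ℂ)]
  rw [← Finset.mul_sum, sum_mul_exp_logForm_liftPt hP hA, mul_one]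

theorem logIntegral_contiguity {n : ℕ} {A : Finset (Fin n → ℤ)} {P : (Fin n → ℤ) → ℝ}
    (hP : ∀ a ∈ A, 0 < P a) {α : ℂ × (Fin n → ℂ)} (hα : rePart α ∈ interior (coneA n A))
    (hαA : ∀ a ∈ A, rePart (α + liftPt a) ∈ interior (coneA n A)) (u : ℂ × (Fin n → ℂ)) :
    pairing u α * logIntegral A P α =
      α.1 * ∑ a ∈ A, pairing u (liftPt a) * P a * logIntegral A P (α + liftPt a) := by
  have h1 : ∑ a ∈ A, pairing u (liftPt a) * P a * logIntegral A P (α + liftPt a) =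
      u.1 * ∑ a ∈ A, (P a : ℂ) * logIntegral A P (α + liftPt a) +
        ∑ i, u.2 i * ∑ a ∈ A, (a i : ℂ) * P a * logIntegral A P (α + liftPt a) := by
    simp only [Finset.mul_sum]
    rw [Finset.sum_comm (s := Finset.univ), ← Finset.sum_add_distrib]
    refine Finset.sum_congr rfl fun a _ => ?_
    simp only [pairing, liftPt, add_mul, Finset.sum_mul, mul_one, mul_assoc]
  rw [h1, ← logIntegral_eq_sum hP hα hαA, pairing, add_mul, mul_add, Finset.sum_mul,
    Finset.mul_sum]
  congr 1
  · ring
  · refine Finset.sum_congr rfl fun i _ => ?_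
    rw [mul_assoc, logIntegral_contiguity_coord hP hα hαA i]
    ring

theorem pairing_castVec_re {n : ℕ} (w : ℤ × (Fin n → ℤ)) (α : ℂ × (Fin n → ℂ)) :
    (pairing (castVec w) α).re = (w.1 : ℝ) * (rePart α).1 + ∑ i, (w.2 i : ℝ) * (rePart α).2 i := by
  simp only [pairing, castVec, rePart, Complex.add_re, Complex.re_sum]
  simp [Complex.mul_re]

theorem facet_nonneg {n : ℕ} {A : Finset (Fin n → ℤ)}
    {W : Finset (ℤ × (Fin n → ℤ))} (hW : ∀ x : ℝ × (Fin n → ℝ), x ∈ coneA n A ↔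
      ∀ w ∈ W, 0 ≤ (w.1 : ℝ) * x.1 + ∑ i, (w.2 i : ℝ) * x.2 i)
    (w : ℤ × (Fin n → ℤ)) (hw : w ∈ W) (a : Fin n → ℤ) (ha : a ∈ A) :
    0 ≤ w.1 + ∑ i, w.2 i * a i := by
  have hmem : ((1 : ℝ), fun i => (a i : ℝ)) ∈ coneA n A := by
    refine ⟨fun b => if b = a then 1 else 0, fun b => by dsimp only; split_ifs <;> norm_num, ?_⟩
    simp [ite_smul, Finset.sum_ite_eq', ha]
  have := (hW _).1 hmem w hw
  simp only [mul_one] at this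
  exact_mod_cast this

theorem rePart_mem_interior_of_mem_halfSpaces {n : ℕ} {A : Finset (Fin n → ℤ)}
    {W : Finset (ℤ × (Fin n → ℤ))} (hW : ∀ x : ℝ × (Fin n → ℝ), x ∈ coneA n A ↔
      ∀ w ∈ W, 0 ≤ (w.1 : ℝ) * x.1 + ∑ i, (w.2 i : ℝ) * x.2 i)
    {α : ℂ × (Fin n → ℂ)}
    (hα : α ∈ halfSpaces W 0) : rePart α ∈ interior (coneA n A) := by
  refine mem_interior.2 ⟨{x | ∀ w ∈ W, 0 < (w.1 : ℝ) * x.1 + ∑ i, (w.2 i : ℝ) * x.2 i},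
    fun x hx => (hW x).2 fun w hw => (hx w hw).le, ?_, fun w hw => ?_⟩
  · have : {x : ℝ × (Fin n → ℝ) | ∀ w ∈ W, 0 < (w.1 : ℝ) * x.1 + ∑ i, (w.2 i : ℝ) * x.2 i} =
        ⋂ w ∈ W, {x | 0 < (w.1 : ℝ) * x.1 + ∑ i, (w.2 i : ℝ) * x.2 i} := by
      ext; simp
    rw [this]
    exact isOpen_biInter_finset fun w _ => isOpen_lt continuous_const (by fun_prop)
  · rw [← pairing_castVec_re]
    simpa using hα w hw

theorem mem_halfSpaces_of_rePart_mem_interior {n : ℕ} {A : Finset (Fin n → ℤ)}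
    {W : Finset (ℤ × (Fin n → ℤ))} (hW : ∀ x : ℝ × (Fin n → ℝ), x ∈ coneA n A ↔
      ∀ w ∈ W, 0 ≤ (w.1 : ℝ) * x.1 + ∑ i, (w.2 i : ℝ) * x.2 i)
    (h0 : (0 : ℤ × (Fin n → ℤ)) ∉ W)
    {α : ℂ × (Fin n → ℂ)} (hα : rePart α ∈ interior (coneA n A)) : α ∈ halfSpaces W 0 := by
  intro w hw
  rw [pairing_castVec_re]
  let v : ℝ × (Fin n → ℝ) := (w.1, fun i => w.2 i)
  have hcont : Filter.Tendsto (fun t : ℝ => rePart α - t • v) (nhds 0) (nhds (rePart α)) := by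
    have : Continuous fun t : ℝ => rePart α - t • v := by fun_prop
    simpa using this.tendsto 0
  have hev := (hcont.eventually (mem_interior_iff_mem_nhds.1 hα)).filter_mono
    (nhdsWithin_le_nhds (s := Set.Ioi 0))
  obtain ⟨t, ht, htpos⟩ := (hev.and self_mem_nhdsWithin).exists
  have h1 := (hW _).1 ht w hw
  have hsq : 0 < (w.1 : ℝ) * w.1 + ∑ i, (w.2 i : ℝ) * w.2 i := by
    by_contra hcon
    have hs : 0 ≤ ∑ i, (w.2 i : ℝ) * w.2 i := Finset.sum_nonneg fun i _ => mul_self_nonneg _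
    have hf := mul_self_nonneg (w.1 : ℝ)
    have hs0 : ∑ i, (w.2 i : ℝ) * w.2 i = 0 := by linarith
    have hf0 : (w.1 : ℝ) * w.1 = 0 := by linarith
    rw [Finset.sum_eq_zero_iff_of_nonneg fun i _ => mul_self_nonneg _] at hs0
    refine h0 ((?_ : w = 0) ▸ hw)
    refine Prod.ext (by simpa using hf0) (funext fun i => ?_)
    simpa using hs0 i (Finset.mem_univ i)
  have h2 : (w.1 : ℝ) * (rePart α - t • v).1 + ∑ i, (w.2 i : ℝ) * (rePart α - t • v).2 i =
      (w.1 : ℝ) * (rePart α).1 + ∑ i, (w.2 i : ℝ) * (rePart α).2 i -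
        t * ((w.1 : ℝ) * w.1 + ∑ i, (w.2 i : ℝ) * w.2 i) := by
    simp only [Prod.fst_sub, Prod.snd_sub, Prod.smul_fst, Prod.smul_snd, Pi.sub_apply,
      Pi.smul_apply, smul_eq_mul, mul_sub, Finset.sum_sub_distrib, v, mul_add, Finset.mul_sum,
      mul_left_comm t]
    ring
  rw [h2] at h1
  have h3 := mul_pos (Set.mem_Ioi.1 htpos) hsq
  simp only [Pi.zero_apply, Nat.cast_zero, neg_zero]
  linarith

theorem notMem_poleSet_of_mem_halfSpaces {n : ℕ} {A : Finset (Fin n → ℤ)}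
    {W : Finset (ℤ × (Fin n → ℤ))} (hW : ∀ x : ℝ × (Fin n → ℝ), x ∈ coneA n A ↔
      ∀ w ∈ W, 0 ≤ (w.1 : ℝ) * x.1 + ∑ i, (w.2 i : ℝ) * x.2 i)
    {α : ℂ × (Fin n → ℂ)} (hα : α ∈ halfSpaces W 0) :
    α ∉ poleSet n A W := by
  rintro ⟨w, hw, m, hm, h⟩
  have hm' : 0 ≤ w.1 * m.1 + ∑ i, w.2 i * m.2 i := by
    clear h
    induction hm using AddSubmonoid.closure_induction with
    | mem x hx =>
      obtain ⟨a, ha, rfl⟩ := hx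
      simpa using facet_nonneg hW w hw a ha
    | zero => simp
    | add x y _ _ hx hy =>
      simp only [Prod.fst_add, Prod.snd_add, Pi.add_apply, mul_add, Finset.sum_add_distrib]
      linarith
  have h1 := hα w hw
  have h2 : (pairing (castVec w) α).re = -((w.1 * m.1 + ∑ i, w.2 i * m.2 i : ℤ) : ℝ) := by
    rw [show pairing (castVec w) α = _ from h, Complex.neg_re, Complex.intCast_re]
  have h3 : (0 : ℝ) ≤ ((w.1 * m.1 + ∑ i, w.2 i * m.2 i : ℤ) : ℝ) := by exact_mod_cast hm'
  rw [h2] at h1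
  simp only [Pi.zero_apply, Nat.cast_zero, neg_zero] at h1
  linarith

theorem add_liftPt_mem_halfSpaces {n : ℕ} {A : Finset (Fin n → ℤ)}
    {W : Finset (ℤ × (Fin n → ℤ))} (hW : ∀ x : ℝ × (Fin n → ℝ), x ∈ coneA n A ↔
      ∀ w ∈ W, 0 ≤ (w.1 : ℝ) * x.1 + ∑ i, (w.2 i : ℝ) * x.2 i)
    {α : ℂ × (Fin n → ℂ)} (hα : α ∈ halfSpaces W 0)
    {a : Fin n → ℤ} (ha : a ∈ A) : α + liftPt a ∈ halfSpaces W 0 := by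
  intro w hw
  rw [pairing_add, pairing_castVec_liftPt, Complex.add_re, Complex.intCast_re]
  have h1 := hα w hw
  have h2 : (0 : ℝ) ≤ ((w.1 + ∑ i, w.2 i * a i : ℤ) : ℝ) := by
    exact_mod_cast facet_nonneg hW w hw a ha
  linarith

theorem isContinuation_logIntegral {n : ℕ} {A : Finset (Fin n → ℤ)}
    {W : Finset (ℤ × (Fin n → ℤ))} (hW : ∀ x : ℝ × (Fin n → ℝ), x ∈ coneA n A ↔
      ∀ w ∈ W, 0 ≤ (w.1 : ℝ) * x.1 + ∑ i, (w.2 i : ℝ) * x.2 i)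
    {P : (Fin n → ℤ) → ℝ} (hP : ∀ a ∈ A, 0 < P a) :
    IsContinuation A P W (halfSpaces W 0) (logIntegral A P) where
  isOpen := by
    have : halfSpaces W 0 = ⋂ w ∈ W, {α | 0 < (pairing (castVec w) α).re} := by
      ext; simp [halfSpaces]
    rw [this]
    exact isOpen_biInter_finset fun w _ => isOpen_lt continuous_const
      (Complex.continuous_re.comp (continuous_pairing _))
  add_mem _ hα _ ha := add_liftPt_mem_halfSpaces hW hα ha
  analyticAt _ hα _ := analyticAt_logIntegral hP (rePart_mem_interior_of_mem_halfSpaces hW hα)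
  contiguity _ hα _ u := logIntegral_contiguity hP (rePart_mem_interior_of_mem_halfSpaces hW hα)
    (fun _ ha => rePart_mem_interior_of_mem_halfSpaces hW (add_liftPt_mem_halfSpaces hW hα ha)) u

theorem poleSet_eq_univ_of_zero_mem {n : ℕ} (A : Finset (Fin n → ℤ))
    {W : Finset (ℤ × (Fin n → ℤ))} (h0 : (0 : ℤ × (Fin n → ℤ)) ∈ W) :
    poleSet n A W = Set.univ :=
  Set.eq_univ_of_forall fun α => ⟨0, h0, 0, zero_mem _, by simp⟩

/-- `K(α)` extends to a meromorphic function on `ℂ^{n+1}`: it is analytic away from the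
`-Σ` translates of the facet hyperplanes of the cone `C_A`, agrees with the convergent
integral on the interior of the cone, and the contiguity relation
`⟨w, α⟩K(α) = α₀ Σ_a ⟨w,a⟩ P_a K(α+a)` holds identically. -/
theorem toric_meromorphic_continuation (n : ℕ) (A : Finset (Fin n → ℤ))
    (P : (Fin n → ℤ) → ℝ) (hP : ∀ a ∈ A, 0 < P a)
    (W : Finset (ℤ × (Fin n → ℤ)))
    (hW : ∀ x : ℝ × (Fin n → ℝ), x ∈ coneA n A ↔
      ∀ w ∈ W, 0 ≤ (w.1 : ℝ) * x.1 + ∑ i, (w.2 i : ℝ) * x.2 i) :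
    ∃ G : ℂ × (Fin n → ℂ) → ℂ,
      AnalyticOnNhd ℂ G (poleSet n A W)ᶜ ∧
      (∀ (α0 : ℂ) (α : Fin n → ℂ),
        ((α0.re, fun i => (α i).re) : ℝ × (Fin n → ℝ)) ∈ interior (coneA n A) →
        G (α0, α) = Kint n A P α0 α) ∧
      (∀ (w0 : ℤ) (w : Fin n → ℤ) (α0 : ℂ) (α : Fin n → ℂ),
        (α0, α) ∉ poleSet n A W →
        (∀ a ∈ A, ((α0 + 1, fun i => α i + (a i : ℂ)) : ℂ × (Fin n → ℂ)) ∉ poleSet n A W) →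
        ((w0 : ℂ) * α0 + ∑ i, (w i : ℂ) * α i) * G (α0, α) =
          α0 * ∑ a ∈ A, ((w0 : ℂ) + ∑ i, (w i : ℂ) * (a i : ℂ)) * (P a : ℂ) *
            G (α0 + 1, fun i => α i + (a i : ℂ))) := by
  by_cases h0 : (0 : ℤ × (Fin n → ℤ)) ∈ W
  · refine ⟨fun β => Kint n A P β.1 β.2, ?_, fun _ _ _ => rfl, fun _ _ _ _ h => ?_⟩
    · rw [poleSet_eq_univ_of_zero_mem A h0, Set.compl_univ]
      exact fun _ h => h.elim
    · rw [poleSet_eq_univ_of_zero_mem A h0] at h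
      exact absurd trivial h
  · obtain ⟨G, hG, hGK⟩ :=
      (isContinuation_logIntegral hW hP).exists_global (facet_nonneg hW)
    refine ⟨G, fun β hβ => hG.analyticAt β trivial hβ, fun α0 α hα => ?_,
      fun w0 w α0 α hα _ => ?_⟩
    · have hmem := mem_halfSpaces_of_rePart_mem_interior hW h0 (α := (α0, α)) hα
      rw [hGK _ hmem (notMem_poleSet_of_mem_halfSpaces hW hmem)]
      exact (Kint_eq_logIntegral hP (nonempty_of_mem_interior_coneA hα) (α0, α)).symm
    · have h := hG.contiguity (α0, α) trivial hα (castVec (w0, w))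
      simpa only [pairing, castVec, liftPt, mul_one] using! h
end
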